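/- arXiv:2211.11456 — 3 statements merged into one kernel-verified Lean document; each statement's English description precedes it below -/
import Mathlib

section
/- Let F be an algebraically closed field of characteristic different from 3. Let f be a homogeneous polynomial of degree 3 in four variables over F whose projective zero locus is a smooth cubic surface (no nonzero v ∈ F⁴ with f(v) = 0 and all four partial derivatives of f vanishing at v). Let W₁,…,W₆ be 2-dimensional F-linear subspaces of F⁴ with Wᵢ ∩ Wⱼ = {0} for i ≠ j and with f vanishing identically on each Wᵢ. Suppose t ∈ GL₄(F) maps the cone {v ∈ F⁴ : f(v) = 0} onto itself and satisfies t(W₁) = W₁, t(W₂) = W₂, t(W₃) = W₃, t(W₄) = W₅, t(W₅) = W₆, t(W₆) = W₄. Then the cubic surface is isomorphic to the Fermat cubic: there exists g ∈ GL₄(F) mapping {v ∈ F⁴ : f(v) = 0} onto {v ∈ F⁴ : v₀³ + v₁³ + v₂³ + v₃³ = 0}. -/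
open MvPolynomial

theorem aux_mono3 (m : Fin 4 →₀ ℕ) (hm : m.degree = 3) :
    ∃ i j k, m = Finsupp.single i 1 + Finsupp.single j 1 + Finsupp.single k 1 := by
  have step : ∀ (n : ℕ) (m : Fin 4 →₀ ℕ), m.degree = n + 1 →
      ∃ i m', m'.degree = n ∧ m = Finsupp.single i 1 + m' := by
    intro n m h
    have hne : m ≠ 0 := by rintro rfl; simp at h
    obtain ⟨i, hi⟩ := Finsupp.ne_iff.mp hne
    have hle : Finsupp.single i 1 ≤ m := by
      rw [Finsupp.single_le_iff]
      exact Nat.one_le_iff_ne_zero.mpr hi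
    refine ⟨i, m - Finsupp.single i 1, ?_, (add_tsub_cancel_of_le hle).symm⟩
    have := congrArg Finsupp.degree (add_tsub_cancel_of_le hle)
    rw [map_add, Finsupp.degree_single] at this
    omega
  obtain ⟨i, m1, h1, rfl⟩ := step 2 m hm
  obtain ⟨j, m2, h2, rfl⟩ := step 1 m1 h1
  obtain ⟨k, m3, h3, rfl⟩ := step 0 m2 h2
  have : m3 = 0 := (Finsupp.degree_eq_zero_iff _).mp h3
  subst this
  exact ⟨i, j, k, by simp [add_assoc]⟩

theorem aux_tri {F : Type*} [Field F] (f : MvPolynomial (Fin 4) F) (hf : f.IsHomogeneous 3) :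
    ∃ B : (Fin 4 → F) →ₗ[F] (Fin 4 → F) →ₗ[F] (Fin 4 → F) →ₗ[F] F,
      (∀ v, eval v f = B v v v) ∧
      (∀ v w, B w v v + B v w v + B v v w = ∑ l, w l * eval v (pderiv l f)) := by
  let P : MvPolynomial (Fin 4) F → Prop := fun f =>
    ∃ B : (Fin 4 → F) →ₗ[F] (Fin 4 → F) →ₗ[F] (Fin 4 → F) →ₗ[F] F,
      (∀ v, eval v f = B v v v) ∧
      (∀ v w, B w v v + B v w v + B v v w = ∑ l, w l * eval v (pderiv l f))
  change P f
  rw [f.as_sum]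
  refine Finset.sum_induction _ P ?_ ?_ ?_
  · rintro a b ⟨A, hA, hA'⟩ ⟨B, hB, hB'⟩
    refine ⟨A + B, fun v => by simp [hA, hB], fun v w => ?_⟩
    simp only [LinearMap.add_apply, map_add, mul_add, Finset.sum_add_distrib, ← hA', ← hB']
    ring
  · exact ⟨0, by simp, by simp⟩
  · intro m hm
    have hd : m.degree = 3 := by
      have := hf (mem_support_iff.mp hm)
      rw [Finsupp.degree_eq_weight_one]
      exact this
    obtain ⟨i, j, k, hijk⟩ := aux_mono3 m hd
    generalize coeff m f = c
    have hmon : monomial m c = C c * X i * X j * X k := by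
      subst hijk
      simp [X, C_mul_monomial, monomial_mul]
    rw [hmon]
    refine ⟨c • (LinearMap.proj i).smulRight
      ((LinearMap.proj j).smulRight (LinearMap.proj k)), fun v => ?_, fun v w => ?_⟩
    · simp; ring
    · simp [Derivation.leibniz, pderiv_X, Pi.single_apply, mul_add, Finset.sum_add_distrib,
        apply_ite (eval v)]
      ring

/-- products of cubic functions -/
theorem aux_poly {F : Type*} [Field F]
    (B : (Fin 4 → F) →ₗ[F] (Fin 4 → F) →ₗ[F] (Fin 4 → F) →ₗ[F] F)
    (L M N : (Fin 4 → F) →ₗ[F] (Fin 4 → F)) :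
    ∃ p : MvPolynomial (Fin 4) F, ∀ v, eval v p = B (L v) (M v) (N v) := by
  refine ⟨∑ k, ∑ j, ∑ i, C (B (L (Pi.single i 1)) (M (Pi.single j 1)) (N (Pi.single k 1))) *
    X i * X j * X k, fun v => ?_⟩
  have hv : v = ∑ i, v i • (Pi.single i 1 : Fin 4 → F) := by
    simpa using pi_eq_sum_univ' v
  have hr : B (L v) (M v) (N v) = B (L (∑ i, v i • (Pi.single i 1 : Fin 4 → F)))
    (M (∑ i, v i • (Pi.single i 1 : Fin 4 → F))) (N (∑ i, v i • (Pi.single i 1 : Fin 4 → F))) := by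
    rw [← hv]
  rw [hr]
  simp only [map_sum, map_smul, LinearMap.sum_apply, LinearMap.smul_apply, map_mul, eval_C, eval_X,
    smul_eq_mul, Finset.mul_sum]
  refine Finset.sum_congr rfl fun k _ => Finset.sum_congr rfl fun j _ =>
    Finset.sum_congr rfl fun i _ => ?_
  ring

theorem aux_root {F : Type*} [Field F] [IsAlgClosed F] (a b c d : F) (h : b ≠ 0 ∨ c ≠ 0 ∨ d ≠ 0) :
    ∃ s, a + b * s + c * s ^ 2 + d * s ^ 3 = 0 := by
  have hdeg : (Polynomial.C a + Polynomial.C b * Polynomial.X + Polynomial.C c * Polynomial.X ^ 2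
      + Polynomial.C d * Polynomial.X ^ 3).degree ≠ 0 := by
    intro h0
    have h1 := Polynomial.eq_C_of_degree_eq_zero h0
    have e1 := congrArg (fun p => Polynomial.coeff p 1) h1
    have e2 := congrArg (fun p => Polynomial.coeff p 2) h1
    have e3 := congrArg (fun p => Polynomial.coeff p 3) h1
    simp [Polynomial.coeff_X, Polynomial.coeff_C, Polynomial.coeff_X_pow] at e1 e2 e3
    tauto
  obtain ⟨s, hs⟩ := IsAlgClosed.exists_root _ hdeg
  exact ⟨s, by simpa using hs⟩

theorem aux_K {F : Type*} [Field F] [IsAlgClosed F] (a b c d : F)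
    (h : ∀ r s, a * r ^ 3 + b * r ^ 2 * s + c * r * s ^ 2 + d * s ^ 3 = 0 →
      b * r ^ 2 * s = 0 ∧ c * r * s ^ 2 = 0) (hb : b ≠ 0) : a = 0 ∧ c = 0 ∧ d = 0 := by
  have key : ∀ s, a + b * s + c * s ^ 2 + d * s ^ 3 = 0 → s = 0 := by
    intro s hs
    have := (h 1 s (by linear_combination hs)).1
    simpa [hb] using this
  have ha : a = 0 := by
    obtain ⟨s, hs⟩ := aux_root a b c d (Or.inl hb)
    have := key s hs
    subst this
    simpa using hs
  subst ha
  have : ¬ (c ≠ 0 ∨ d ≠ 0 ∨ (0:F) ≠ 0) := by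
    intro hc
    obtain ⟨s, hs⟩ := aux_root b c d 0 hc
    have := key s (by linear_combination s * hs)
    subst this
    exact hb (by simpa using hs)
  push Not at this
  tauto

theorem aux_main1 {F : Type*} [Field F] [IsAlgClosed F]
    (B : (Fin 4 → F) →ₗ[F] (Fin 4 → F) →ₗ[F] (Fin 4 → F) →ₗ[F] F)
    (hsm : ∀ v, v ≠ 0 → B v v v = 0 → ∃ w, B w v v + B v w v + B v v w ≠ 0)
    (p q : (Fin 4 → F) →ₗ[F] (Fin 4 → F))
    (hpq : ∀ v, p v + q v = v) (hpp : ∀ v, p (p v) = p v) (hqp : ∀ v, q (p v) = 0)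
    (hqq : ∀ v, q (q v) = q v) (hpq0 : ∀ v, p (q v) = 0)
    (y : Fin 4 → F) (hy : y ≠ 0) (hqy : q y = y)
    (l m : F) (hl : l ≠ 0) (hm : m ≠ 0) (hlm : l ≠ m) (h3 : l ^ 2 + l * m + m ^ 2 = 0)
    (hchar : (3 : F) ≠ 0)
    (hT : ∀ v, B v v v = 0 → B (l • p v + m • q v) (l • p v + m • q v) (l • p v + m • q v) = 0) :
    ∀ v, B (p v) (p v) (q v) + B (p v) (q v) (p v) + B (q v) (p v) (p v) = 0 := by
  have hpy : p y = 0 := by rw [← hqy, hpq0]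
  have hexp : ∀ x z : Fin 4 → F, ∀ r s : F, B (r • x + s • z) (r • x + s • z) (r • x + s • z) =
      B x x x * r ^ 3 + (B x x z + B x z x + B z x x) * r ^ 2 * s
        + (B z z x + B z x z + B x z z) * r * s ^ 2 + B z z z * s ^ 3 := by
    intro x z r s
    simp only [map_add, map_smul, LinearMap.add_apply, LinearMap.smul_apply, smul_eq_mul]
    ring
  have hK : ∀ v, (B (p v) (p v) (q v) + B (p v) (q v) (p v) + B (q v) (p v) (p v)) ≠ 0 →
      B (p v) (p v) (p v) = 0 ∧ (B (q v) (q v) (p v) + B (q v) (p v) (q v) + B (p v) (q v) (q v)) = 0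
      ∧ B (q v) (q v) (q v) = 0 := by
    intro v hb
    refine aux_K _ _ _ _ ?_ hb
    intro r s h0
    rw [← hexp] at h0
    have hp1 : ∀ r s : F, p (r • p v + s • q v) = r • p v := by
      intro r s; simp [hpp, hpq0]
    have hq1 : ∀ r s : F, q (r • p v + s • q v) = s • q v := by
      intro r s; simp [hqq, hqp]
    have h1 := hT _ h0
    have h2 := hT _ h1
    simp only [smul_smul, hp1, hq1] at h1 h2
    rw [hexp] at h0 h1 h2
    have hm3 : m ^ 3 = l ^ 3 := by linear_combination (m - l) * h3
    generalize (B (p v) (p v) (q v) + B (p v) (q v) (p v) + B (q v) (p v) (p v)) = b at *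
    generalize (B (q v) (q v) (p v) + B (q v) (p v) (q v) + B (p v) (q v) (q v)) = c at *
    generalize (B (p v) (p v) (p v)) = a at *
    generalize (B (q v) (q v) (q v)) = d at *
    have e1 : (a * r ^ 3 + d * s ^ 3) * l ^ 2 + (b * r ^ 2 * s) * l * m + (c * r * s ^ 2) * m ^ 2 = 0 := by
      apply mul_left_cancel₀ hl
      linear_combination h1 - d * s ^ 3 * hm3
    have e2 : (a * r ^ 3 + d * s ^ 3) * l ^ 2 + (b * r ^ 2 * s) * m ^ 2 + (c * r * s ^ 2) * l * m = 0 := by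
      apply mul_left_cancel₀ (pow_ne_zero 4 hl)
      linear_combination h2 - d * s ^ 3 * (m ^ 3 + l ^ 3) * hm3 - c * r * s ^ 2 * l ^ 2 * m * hm3
    have e0 : (a * r ^ 3 + d * s ^ 3) + (b * r ^ 2 * s)  + (c * r * s ^ 2) = 0 := by
      linear_combination h0
    generalize (a * r ^ 3 + d * s ^ 3) = A at *
    generalize b * r ^ 2 * s = b' at *
    generalize c * r * s ^ 2 = c' at *
    have hA : A = 0 := by
      apply mul_left_cancel₀ (mul_ne_zero hchar (pow_ne_zero 2 hl))
      linear_combination l ^ 2 * e0 + e1 + e2 - (b' + c') * h3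
    subst hA
    have hc' : c' = -b' := by linear_combination e0
    subst hc'
    have : b' = 0 := by
      have : b' * (m * (l - m)) = 0 := by linear_combination e1
      rcases mul_eq_zero.mp this with h | h
      · exact h
      · exact absurd h (mul_ne_zero hm (sub_ne_zero.mpr hlm))
    subst this
    simp
  by_contra hcon
  push Not at hcon
  obtain ⟨v0, hv0⟩ := hcon
  obtain ⟨b1, hb1⟩ := aux_poly B p p q
  obtain ⟨b2, hb2⟩ := aux_poly B p q p
  obtain ⟨b3, hb3⟩ := aux_poly B q p p
  obtain ⟨c1, hc1⟩ := aux_poly B q q p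
  obtain ⟨c2, hc2⟩ := aux_poly B q p q
  obtain ⟨c3, hc3⟩ := aux_poly B p q q
  obtain ⟨d, hd⟩ := aux_poly B q q q
  have hbne : b1 + b2 + b3 ≠ 0 := by
    intro h
    have := congrArg (eval v0) h
    simp only [map_add, hb1, hb2, hb3, map_zero] at this
    exact hv0 this
  have : Infinite F := IsAlgClosed.instInfinite
  have hc0 : c1 + c2 + c3 = 0 := by
    have : (b1 + b2 + b3) * (c1 + c2 + c3) = 0 := by
      apply MvPolynomial.funext
      intro v
      simp only [map_add, map_mul, hb1, hb2, hb3, hc1, hc2, hc3, map_zero]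
      by_cases hb : (B (p v) (p v) (q v) + B (p v) (q v) (p v) + B (q v) (p v) (p v)) = 0
      · rw [hb, zero_mul]
      · rw [(hK v hb).2.1, mul_zero]
    exact (mul_eq_zero.mp this).resolve_left hbne
  have hd0 : d = 0 := by
    have : (b1 + b2 + b3) * d = 0 := by
      apply MvPolynomial.funext
      intro v
      simp only [map_add, map_mul, hb1, hb2, hb3, hd, map_zero]
      by_cases hb : (B (p v) (p v) (q v) + B (p v) (q v) (p v) + B (q v) (p v) (p v)) = 0
      · rw [hb, zero_mul]
      · rw [(hK v hb).2.2, mul_zero]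
    exact (mul_eq_zero.mp this).resolve_left hbne
  have hcf : ∀ v, B (q v) (q v) (p v) + B (q v) (p v) (q v) + B (p v) (q v) (q v) = 0 := by
    intro v
    have := congrArg (eval v) hc0
    simpa only [map_add, hc1, hc2, hc3, map_zero] using this
  have hdf : ∀ v, B (q v) (q v) (q v) = 0 := by
    intro v
    have := congrArg (eval v) hd0
    simpa only [hd, map_zero] using this
  obtain ⟨w, hw⟩ := hsm y hy (by have := hdf y; rwa [hqy] at this)
  apply hw
  have h1 := hcf (p w + y)
  simp only [map_add, hpp, hqp, hpy, hqy, zero_add, add_zero] at h1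
  have h2 : B (q w) y y + B y (q w) y + B y y (q w) = 0 := by
    have g : ∀ s : F, B y y (q w) * s + B y (q w) y * s + B (q w) y y * s + 
        (B y (q w) (q w) + B (q w) y (q w) + B (q w) (q w) y) * s ^ 2 = 0 := by
      intro s
      have g0 := hdf (y + s • w)
      have g1 := hdf y
      have g2 := hdf w
      simp only [map_add, map_smul, hqy, LinearMap.add_apply, LinearMap.smul_apply, smul_eq_mul] at g0 g1
      linear_combination g0 - g1 - s ^ 3 * g2
    have gl := g l
    have gm := g m
    apply mul_left_cancel₀ (mul_ne_zero (mul_ne_zero hl hm) (sub_ne_zero.mpr hlm))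
    linear_combination l ^ 2 * gm - m ^ 2 * gl
  have hwe : w = p w + q w := (hpq w).symm
  rw [hwe]
  simp only [map_add, LinearMap.add_apply] 
  linear_combination h1 + h2

theorem aux_prod {F : Type*} [Field F] [IsAlgClosed F] (hchar : (3 : F) ≠ 0)
    (om : F) (hom : om ^ 2 + om + 1 = 0)
    (k a1 a2 b1 b2 c1 c2 : F) (hk : k ≠ 0) (hab : a1 * b2 - a2 * b1 ≠ 0)
    (hbc : b1 * c2 - b2 * c1 ≠ 0) (hca : c1 * a2 - c2 * a1 ≠ 0) :
    ∃ p1 p2 q1 q2 : F, p1 * q2 - p2 * q1 ≠ 0 ∧ ∀ x y,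
      k * (a1 * x + a2 * y) * (b1 * x + b2 * y) * (c1 * x + c2 * y) =
        (p1 * x + p2 * y) ^ 3 + (q1 * x + q2 * y) ^ 3 := by
  obtain ⟨D1, hD1⟩ : ∃ D, D = a1 * b2 - a2 * b1 := ⟨_, rfl⟩
  obtain ⟨D2, hD2⟩ : ∃ D, D = b1 * c2 - b2 * c1 := ⟨_, rfl⟩
  obtain ⟨D3, hD3⟩ : ∃ D, D = c1 * a2 - c2 * a1 := ⟨_, rfl⟩
  rw [← hD1] at hab
  rw [← hD2] at hbc
  rw [← hD3] at hca
  have hr1 : D2 * a1 + D3 * b1 + D1 * c1 = 0 := by subst hD1 hD2 hD3; ring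
  have hr2 : D2 * a2 + D3 * b2 + D1 * c2 = 0 := by subst hD1 hD2 hD3; ring
  obtain ⟨z, hz⟩ := IsAlgClosed.exists_pow_nat_eq (k / (D1 * D2 * D3)) (n := 3) (by norm_num)
  have hz' : z ^ 3 * (D1 * D2 * D3) = k := by rw [hz]; field_simp
  have hz0 : z ≠ 0 := by rintro rfl; apply hk; rw [← hz']; ring
  have hom3 : om ^ 3 = 1 := by linear_combination (om - 1) * hom
  have hid : ∀ L M N : F, L + M + N = 0 →
      27 * (L * M * N) = (L + om ^ 2 * M + om * N) ^ 3 + (L + om * M + om ^ 2 * N) ^ 3 := by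
    intro L M N h
    have hN : N = - L - M := by linear_combination h
    subst hN
    have ho : om ^ 2 = - om - 1 := by linear_combination hom
    rw [ho]
    have ho3 : om ^ 3 = 1 := hom3
    linear_combination (-(36 * L * M ^ 2 + 36 * L ^ 2 * M + 9 * L ^ 3)) * hom
  refine ⟨z / 3 * (D2 * a1 + om ^ 2 * (D3 * b1) + om * (D1 * c1)),
    z / 3 * (D2 * a2 + om ^ 2 * (D3 * b2) + om * (D1 * c2)),
    z / 3 * (D2 * a1 + om * (D3 * b1) + om ^ 2 * (D1 * c1)),
    z / 3 * (D2 * a2 + om * (D3 * b2) + om ^ 2 * (D1 * c2)), ?_, ?_⟩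
  · have : z / 3 * (D2 * a1 + om ^ 2 * (D3 * b1) + om * (D1 * c1)) *
      (z / 3 * (D2 * a2 + om * (D3 * b2) + om ^ 2 * (D1 * c2))) -
      z / 3 * (D2 * a2 + om ^ 2 * (D3 * b2) + om * (D1 * c2)) *
      (z / 3 * (D2 * a1 + om * (D3 * b1) + om ^ 2 * (D1 * c1))) =
      z ^ 2 / 3 * (2 * om + 1) * (D1 * D2 * D3) := by
      have hc1 : D1 * c1 = - (D2 * a1) - D3 * b1 := by linear_combination hr1
      have hc2 : D1 * c2 = - (D2 * a2) - D3 * b2 := by linear_combination hr2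
      have ho : om ^ 2 = - om - 1 := by linear_combination hom
      rw [hc1, hc2, ho]
      field_simp
      rw [hD1]
      ring
    rw [this]
    have h2 : 2 * om + 1 ≠ 0 := by
      intro h
      apply hchar
      linear_combination 4 * hom - (2 * om + 1) * h
    exact mul_ne_zero (mul_ne_zero (div_ne_zero (pow_ne_zero 2 hz0) hchar) h2)
      (mul_ne_zero (mul_ne_zero hab hbc) hca)
  · intro x y
    have := hid (D2 * (a1 * x + a2 * y)) (D3 * (b1 * x + b2 * y)) (D1 * (c1 * x + c2 * y))
      (by linear_combination x * hr1 + y * hr2)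
    have h27 : (27 : F) ≠ 0 := by
      have : (27 : F) = 3 ^ 3 := by norm_num
      rw [this]; exact pow_ne_zero 3 hchar
    apply mul_left_cancel₀ h27
    rw [← hz']
    have hzy : z = 3 * (z / 3) := by field_simp
    generalize z / 3 = y' at hzy
    subst hzy
    linear_combination (27 * y' ^ 3) * this

/-- A smooth binary cubic is a sum of two cubes. -/
theorem aux_bin {F : Type*} [Field F] [IsAlgClosed F] (hchar : (3 : F) ≠ 0)
    (om : F) (hom : om ^ 2 + om + 1 = 0) (a b c d : F)
    (h : ∀ x y : F, 3 * a * x ^ 2 + 2 * b * x * y + c * y ^ 2 = 0 →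
      b * x ^ 2 + 2 * c * x * y + 3 * d * y ^ 2 = 0 →
      a * x ^ 3 + b * x ^ 2 * y + c * x * y ^ 2 + d * y ^ 3 = 0 → x = 0 ∧ y = 0) :
    ∃ p1 p2 q1 q2 : F, p1 * q2 - p2 * q1 ≠ 0 ∧ ∀ x y,
      a * x ^ 3 + b * x ^ 2 * y + c * x * y ^ 2 + d * y ^ 3 =
        (p1 * x + p2 * y) ^ 3 + (q1 * x + q2 * y) ^ 3 := by
  have quad : ∀ b c d : F, b ≠ 0 → ∃ r s : F, c = - b * (r + s) ∧ d = b * r * s := by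
    intro b c d hb
    obtain ⟨r, hr⟩ := IsAlgClosed.exists_root
      (Polynomial.C b * Polynomial.X ^ 2 + Polynomial.C c * Polynomial.X + Polynomial.C d)
      (by rw [Polynomial.degree_quadratic hb]; norm_num)
    have hr' : b * r ^ 2 + c * r + d = 0 := by simpa using hr
    refine ⟨r, - c / b - r, by field_simp; ring, ?_⟩
    field_simp
    linear_combination hr'
  by_cases ha : a = 0
  · subst ha
    have hb : b ≠ 0 := by
      rintro rfl
      have := h 1 0 (by ring) (by ring) (by ring)
      simp at this
    obtain ⟨r, s, rfl, rfl⟩ := quad b c d hb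
    have hrs : r ≠ s := by
      rintro rfl
      have := h r 1 (by ring) (by ring) (by ring)
      simp at this
    obtain ⟨p1, p2, q1, q2, hne, he⟩ := aux_prod hchar om hom b 0 1 1 (-r) 1 (-s) hb (by simp)
      (by intro h; apply hrs; linear_combination h) (by simp)
    refine ⟨p1, p2, q1, q2, hne, fun x y => ?_⟩
    rw [← he]
    ring
  · obtain ⟨r, hr⟩ := IsAlgClosed.exists_root
      (Polynomial.C a * Polynomial.X ^ 3 + Polynomial.C b * Polynomial.X ^ 2 +
        Polynomial.C c * Polynomial.X + Polynomial.C d)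
      (by rw [Polynomial.degree_cubic ha]; norm_num)
    have hr' : a * r ^ 3 + b * r ^ 2 + c * r + d = 0 := by simpa using hr
    obtain ⟨s, t, h1, h2⟩ := quad a (b + a * r) (c + b * r + a * r ^ 2) ha
    have hb : b = - a * (r + s + t) := by linear_combination h1
    have hc : c = a * (r * s + r * t + s * t) := by rw [hb] at h2; linear_combination h2
    have hd : d = - a * r * s * t := by rw [hb, hc] at hr'; linear_combination hr'
    subst hb hc hd
    have hrs : r ≠ s := by
      rintro rfl
      have := h r 1 (by ring) (by ring) (by ring)
      simp at this
    have hrt : r ≠ t := by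
      rintro rfl
      have := h r 1 (by ring) (by ring) (by ring)
      simp at this
    have hst : s ≠ t := by
      rintro rfl
      have := h s 1 (by ring) (by ring) (by ring)
      simp at this
    obtain ⟨p1, p2, q1, q2, hne, he⟩ := aux_prod hchar om hom a 1 (-r) 1 (-s) 1 (-t) ha
      (by intro h; apply hrs; linear_combination h) (by intro h; apply hst; linear_combination h)
      (by intro h; apply hrt; linear_combination -h)
    refine ⟨p1, p2, q1, q2, hne, fun x y => ?_⟩
    rw [← he]
    ring

theorem aux_li {F : Type*} [Field F] {V : Type*} [AddCommGroup V] [Module F V]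
    (W : Fin 6 → Submodule F V)
    (hskew : ∀ i j, i ≠ j → W i ⊓ W j = ⊥) (u u' w w' : V)
    (hu : u ∈ W 0) (hu' : u' ∈ W 0) (hw : w ∈ W 1) (hw' : w' ∈ W 1)
    (hi : ∀ a b : F, a • u + b • u' = 0 → a = 0 ∧ b = 0)
    (hi' : ∀ a b : F, a • w + b • w' = 0 → a = 0 ∧ b = 0) :
    LinearIndependent F ![u, w, u', w'] := by
  rw [Fintype.linearIndependent_iff]
  intro g hg
  simp only [Fin.sum_univ_four, Matrix.cons_val] at hg
  have hz : g 0 • u + g 2 • u' = 0 := by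
    have : g 0 • u + g 2 • u' ∈ W 0 ⊓ W 1 := by
      refine ⟨(W 0).add_mem ((W 0).smul_mem _ hu) ((W 0).smul_mem _ hu'), ?_⟩
      have e : g 0 • u + g 2 • u' = -(g 1 • w + g 3 • w') := by
        rw [eq_neg_iff_add_eq_zero, ← hg]; abel
      rw [e]
      exact (W 1).neg_mem ((W 1).add_mem ((W 1).smul_mem _ hw) ((W 1).smul_mem _ hw'))
    rw [hskew 0 1 (by decide)] at this
    simpa using this
  have hz' : g 1 • w + g 3 • w' = 0 := by
    have e : g 1 • w + g 3 • w' = -(g 0 • u + g 2 • u') := by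
      rw [eq_neg_iff_add_eq_zero, ← hg]; abel
    rw [e, hz, neg_zero]
  obtain ⟨h0, h2⟩ := hi _ _ hz
  obtain ⟨h1, h3⟩ := hi' _ _ hz'
  intro i
  fin_cases i <;> assumption

theorem aux_lin {F : Type*} [Field F] [IsAlgClosed F] (hchar : (3 : F) ≠ 0)
    (W : Fin 6 → Submodule F (Fin 4 → F))
    (hdim : ∀ i, Module.finrank F (W i) = 2)
    (hskew : ∀ i j, i ≠ j → W i ⊓ W j = ⊥)
    (T : (Fin 4 → F) →ₗ[F] (Fin 4 → F)) (hTinj : Function.Injective T)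
    (ht1 : ∀ x ∈ W 0, T x ∈ W 0)
    (ht2 : ∀ x ∈ W 1, T x ∈ W 1)
    (ht3 : ∀ x ∈ W 2, T x ∈ W 2)
    (ht4 : ∀ x ∈ W 3, T x ∈ W 4)
    (ht5 : ∀ x ∈ W 4, T x ∈ W 5)
    (ht6 : ∀ x ∈ W 5, T x ∈ W 3) :
    ∃ (l m : F) (e : Module.Basis (Fin 4) F (Fin 4 → F)), l ≠ 0 ∧ m ≠ 0 ∧ l ≠ m ∧
      l ^ 2 + l * m + m ^ 2 = 0 ∧
      T (e 0) = l • e 0 ∧ T (e 1) = l • e 1 ∧ T (e 2) = m • e 2 ∧ T (e 3) = m • e 3 := by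
  have hsk : ∀ i j, i ≠ j → ∀ x, x ∈ W i → x ∈ W j → x = 0 := by
    intro i j hij x hi hj
    have : x ∈ W i ⊓ W j := ⟨hi, hj⟩
    rw [hskew i j hij] at this
    simpa using this
  have : Nontrivial (W 0) := Module.nontrivial_of_finrank_pos (R := F) (by rw [hdim]; norm_num)
  obtain ⟨l, hl⟩ := Module.End.exists_eigenvalue (T.restrict ht1)
  obtain ⟨⟨u, hu⟩, hul⟩ := hl.exists_hasEigenvector
  have hTu : T u = l • u := congrArg Subtype.val hul.apply_eq_smul
  have hu0 : u ≠ 0 := fun h => hul.2 (Subtype.ext h)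
  obtain ⟨u', hu', hun⟩ : ∃ u' ∈ W 0, u' ∉ Submodule.span F {u} := by
    by_contra hcon
    push Not at hcon
    have hle : W 0 ≤ Submodule.span F {u} := hcon
    have := Submodule.finrank_mono hle
    rw [hdim, finrank_span_singleton hu0] at this
    omega
  have hi : ∀ a b : F, a • u + b • u' = 0 → a = 0 ∧ b = 0 := by
    intro a b h
    have hb : b = 0 := by
      by_contra hb
      apply hun
      rw [Submodule.mem_span_singleton]
      refine ⟨- (b⁻¹ * a), ?_⟩
      have : u' = b⁻¹ • (b • u') := by rw [smul_smul, inv_mul_cancel₀ hb, one_smul]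
      rw [this, eq_neg_of_add_eq_zero_right h, smul_neg, smul_smul, neg_smul]
    subst hb
    simpa [hu0] using h
  have hspan : ∀ x ∈ W 0, ∃ a b : F, x = a • u + b • u' := by
    have hli : LinearIndependent F ![u, u'] := by
      rw [LinearIndependent.pair_iff]; exact hi
    have hle : Submodule.span F (Set.range ![u, u']) ≤ W 0 := by
      rw [Submodule.span_le]
      rintro _ ⟨i, rfl⟩
      fin_cases i <;> assumption
    have heq := Submodule.eq_of_le_of_finrank_eq hle
      (by rw [finrank_span_eq_card hli, hdim]; rfl)
    intro x hx
    rw [← heq, Matrix.range_cons, Matrix.range_cons, Matrix.range_empty, Set.union_empty,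
      Set.singleton_union] at hx
    obtain ⟨a, b, h⟩ := Submodule.mem_span_pair.mp hx
    exact ⟨a, b, h.symm⟩
  obtain ⟨a, m, hTu'⟩ := hspan _ (ht1 _ hu')
  have htop : W 1 ⊔ W 2 = ⊤ := by
    apply Submodule.eq_top_of_finrank_eq
    have := Submodule.finrank_sup_add_finrank_inf_eq (W 1) (W 2)
    rw [hskew 1 2 (by decide), hdim, hdim, finrank_bot] at this
    rw [Module.finrank_fin_fun]
    omega
  have htr : ∀ x : Fin 4 → F, ∃ y ∈ W 1, x - y ∈ W 2 := by
    intro x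
    have : x ∈ W 1 ⊔ W 2 := by rw [htop]; trivial
    obtain ⟨y, hy, z, hz, rfl⟩ := Submodule.mem_sup.mp this
    exact ⟨y, hy, by simpa using hz⟩
  obtain ⟨w, hw, huw⟩ := htr u
  obtain ⟨w', hw', huw'⟩ := htr u'
  have hTw : T w = l • w := by
    rw [← sub_eq_zero]
    apply hsk 1 2 (by decide)
    · exact (W 1).sub_mem (ht2 _ hw) ((W 1).smul_mem _ hw)
    · have h1 := ht3 _ huw
      have h2 := (W 2).smul_mem l huw
      have : T w - l • w = l • (u - w) - T (u - w) := by
        rw [map_sub, hTu, smul_sub]; abel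
      rw [this]
      exact (W 2).sub_mem h2 h1
  have hTw' : T w' = a • w + m • w' := by
    rw [← sub_eq_zero]
    apply hsk 1 2 (by decide)
    · exact (W 1).sub_mem (ht2 _ hw') ((W 1).add_mem ((W 1).smul_mem _ hw) ((W 1).smul_mem _ hw'))
    · have h1 := ht3 _ huw'
      have h2 := (W 2).add_mem ((W 2).smul_mem a huw) ((W 2).smul_mem m huw')
      have : T w' - (a • w + m • w') = (a • (u - w) + m • (u' - w')) - T (u' - w') := by
        rw [map_sub, hTu', smul_sub, smul_sub]; abel
      rw [this]
      exact (W 2).sub_mem h2 h1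
  have hi' : ∀ a b : F, a • w + b • w' = 0 → a = 0 ∧ b = 0 := by
    intro a b h
    apply hi
    apply hsk 0 2 (by decide)
    · exact (W 0).add_mem ((W 0).smul_mem _ hu) ((W 0).smul_mem _ hu')
    · have h2 := (W 2).add_mem ((W 2).smul_mem a huw) ((W 2).smul_mem b huw')
      have : a • u + b • u' = (a • (u - w) + b • (u' - w')) + (a • w + b • w') := by
        rw [smul_sub, smul_sub]; abel
      rw [this, h, add_zero]
      exact h2
  have hli := aux_li W hskew u u' w w' hu hu' hw hw' hi hi'
  have hcard : Fintype.card (Fin 4) = Module.finrank F (Fin 4 → F) := by simp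
  have hquad : ∀ x, T (T x) = (l + m) • T x - (l * m) • x := by
    have : T ∘ₗ T = (l + m) • T - (l * m) • LinearMap.id := by
      apply (basisOfLinearIndependentOfCardEqFinrank hli hcard).ext
      intro i
      fin_cases i
      all_goals
        simp [hTu, hTu', hTw, hTw']
        module
    intro x
    exact LinearMap.congr_fun this x
  have hl0 : l ≠ 0 := by
    rintro rfl
    apply hu0
    apply hTinj
    rw [hTu, zero_smul, map_zero]
  have h3 : l ^ 2 + l * m + m ^ 2 = 0 := by
    by_contra hne
    have hall : ∀ x ∈ W 3, x = 0 := by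
      intro x hx
      have h1 := ht6 _ (ht5 _ (ht4 _ hx))
      have e : T (T (T x)) = (l ^ 2 + l * m + m ^ 2) • T x - ((l + m) * (l * m)) • x := by
        rw [hquad (T x), hquad x]
        module
      rw [e] at h1
      have h2 : (l ^ 2 + l * m + m ^ 2) • T x ∈ W 3 := by
        have := (W 3).add_mem h1 ((W 3).smul_mem ((l + m) * (l * m)) hx)
        simpa using this
      have h4 : T x ∈ W 3 := ((W 3).smul_mem_iff hne).mp h2
      have h5 := hsk 3 4 (by decide) _ h4 (ht4 _ hx)
      apply hTinj
      rw [h5, map_zero]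
    have hb : W 3 = ⊥ := (Submodule.eq_bot_iff _).mpr hall
    have := hdim 3
    rw [hb, finrank_bot] at this
    omega
  have hm0 : m ≠ 0 := by
    rintro rfl
    apply pow_ne_zero 2 hl0
    linear_combination h3
  have hlm : l ≠ m := by
    rintro rfl
    apply mul_ne_zero hchar (pow_ne_zero 2 hl0)
    linear_combination h3
  have hml : m - l ≠ 0 := sub_ne_zero.mpr hlm.symm
  have hli2 := aux_li W hskew u (a • u + (m - l) • u') w (a • w + (m - l) • w') hu
    ((W 0).add_mem ((W 0).smul_mem _ hu) ((W 0).smul_mem _ hu')) hw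
    ((W 1).add_mem ((W 1).smul_mem _ hw) ((W 1).smul_mem _ hw'))
    (by
      intro c d h
      have := hi (c + d * a) (d * (m - l)) (by rw [← h]; module)
      have hd : d = 0 := (mul_eq_zero.mp this.2).resolve_right hml
      subst hd
      simpa using this)
    (by
      intro c d h
      have := hi' (c + d * a) (d * (m - l)) (by rw [← h]; module)
      have hd : d = 0 := (mul_eq_zero.mp this.2).resolve_right hml
      subst hd
      simpa using this)
  refine ⟨l, m, basisOfLinearIndependentOfCardEqFinrank hli2 hcard, hl0, hm0, hlm, h3, ?_, ?_, ?_, ?_⟩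
  · simp [hTu]
  · simp [hTw]
  · simp [hTu, hTu']; module
  · simp [hTw, hTw']; module

set_option maxHeartbeats 2000000 in
/-- The algebraic core: in an eigenbasis of `T`, the form is a sum of four cubes. -/
theorem aux_core {F : Type*} [Field F] [IsAlgClosed F] (hchar : (3 : F) ≠ 0)
    (B : (Fin 4 → F) →ₗ[F] (Fin 4 → F) →ₗ[F] (Fin 4 → F) →ₗ[F] F)
    (hsm : ∀ v, v ≠ 0 → B v v v = 0 → ∃ w, B w v v + B v w v + B v v w ≠ 0)
    (T : (Fin 4 → F) →ₗ[F] (Fin 4 → F))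
    (hT : ∀ v, B v v v = 0 → B (T v) (T v) (T v) = 0)
    (l m : F) (e : Module.Basis (Fin 4) F (Fin 4 → F)) (hl : l ≠ 0) (hm : m ≠ 0) (hlm : l ≠ m)
    (h3 : l ^ 2 + l * m + m ^ 2 = 0)
    (he0 : T (e 0) = l • e 0) (he1 : T (e 1) = l • e 1)
    (he2 : T (e 2) = m • e 2) (he3 : T (e 3) = m • e 3) :
    ∃ g : (Fin 4 → F) ≃ₗ[F] (Fin 4 → F), ∀ v,
      B v v v = g v 0 ^ 3 + g v 1 ^ 3 + g v 2 ^ 3 + g v 3 ^ 3 := by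
  let p : (Fin 4 → F) →ₗ[F] (Fin 4 → F) := e.constr F ![e 0, e 1, 0, 0]
  let q : (Fin 4 → F) →ₗ[F] (Fin 4 → F) := e.constr F ![0, 0, e 2, e 3]
  have p0 : p (e 0) = e 0 := by simp [p]
  have p1 : p (e 1) = e 1 := by simp [p]
  have p2 : p (e 2) = 0 := by simp [p]
  have p3 : p (e 3) = 0 := by simp [p]
  have q0 : q (e 0) = 0 := by simp [q]
  have q1 : q (e 1) = 0 := by simp [q]
  have q2 : q (e 2) = e 2 := by simp [q]
  have q3 : q (e 3) = e 3 := by simp [q]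
  have hext : ∀ L M : (Fin 4 → F) →ₗ[F] (Fin 4 → F), L (e 0) = M (e 0) → L (e 1) = M (e 1) →
      L (e 2) = M (e 2) → L (e 3) = M (e 3) → ∀ v, L v = M v := by
    intro L M h0 h1 h2 h3 v
    have : L = M := by
      apply e.ext
      intro i
      fin_cases i <;> assumption
    rw [this]
  have hpq : ∀ v, p v + q v = v :=
    hext (p + q) LinearMap.id (by simp [p0, q0]) (by simp [p1, q1]) (by simp [p2, q2])
      (by simp [p3, q3])
  have hpp : ∀ v, p (p v) = p v :=
    hext (p ∘ₗ p) p (by simp [p0]) (by simp [p1]) (by simp [p2]) (by simp [p3])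
  have hqq : ∀ v, q (q v) = q v :=
    hext (q ∘ₗ q) q (by simp [q0]) (by simp [q1]) (by simp [q2]) (by simp [q3])
  have hpq0 : ∀ v, p (q v) = 0 :=
    hext (p ∘ₗ q) 0 (by simp [q0]) (by simp [q1]) (by simp [q2, p2]) (by simp [q3, p3])
  have hqp0 : ∀ v, q (p v) = 0 :=
    hext (q ∘ₗ p) 0 (by simp [p0, q0]) (by simp [p1, q1]) (by simp [p2]) (by simp [p3])
  have hTe : ∀ v, T v = l • p v + m • q v :=
    hext T (l • p + m • q) (by simp [p0, q0, he0]) (by simp [p1, q1, he1]) (by simp [p2, q2, he2])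
      (by simp [p3, q3, he3])
  have hb := aux_main1 B hsm p q hpq hpp hqp0 hqq hpq0 (e 2) (e.ne_zero 2) q2 l m hl hm hlm h3 hchar
    (fun v h => by rw [← hTe]; exact hT v h)
  have hc := aux_main1 B hsm q p (fun v => by rw [add_comm, hpq]) hqq hpq0 hpp hqp0 (e 0)
    (e.ne_zero 0) p0 m l hm hl hlm.symm (by linear_combination h3) hchar
    (fun v h => by rw [add_comm, ← hTe]; exact hT v h)
  have hb' : ∀ x y, q x = 0 → p y = 0 → B x x y + B x y x + B y x x = 0 := by
    intro x y hx hy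
    have hx' : p x = x := by have := hpq x; rwa [hx, add_zero] at this
    have hy' : q y = y := by have := hpq y; rwa [hy, zero_add] at this
    have := hb (x + y)
    simpa only [map_add, hx, hy, hx', hy', add_zero, zero_add] using this
  have hc' : ∀ x y, q x = 0 → p y = 0 → B y y x + B y x y + B x y y = 0 := by
    intro x y hx hy
    have hx' : p x = x := by have := hpq x; rwa [hx, add_zero] at this
    have hy' : q y = y := by have := hpq y; rwa [hy, zero_add] at this
    have := hc (x + y)
    simpa only [map_add, hx, hy, hx', hy', add_zero, zero_add] using this
  have hom : (m / l) ^ 2 + m / l + 1 = 0 := by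
    field_simp
    linear_combination h3
  have hind : ∀ x0 x1 x2 x3 : F, x0 • e 0 + x1 • e 1 + x2 • e 2 + x3 • e 3 = 0 →
      x0 = 0 ∧ x1 = 0 ∧ x2 = 0 ∧ x3 = 0 := by
    intro x0 x1 x2 x3 h
    have := Fintype.linearIndependent_iff.mp e.linearIndependent ![x0, x1, x2, x3]
      (by simpa [Fin.sum_univ_four] using h)
    exact ⟨this 0, this 1, this 2, this 3⟩
  obtain ⟨a1, a2, b1, b2, hd1, hs1⟩ := aux_bin hchar (m / l) hom (B (e 0) (e 0) (e 0))
    (B (e 0) (e 0) (e 1) + B (e 0) (e 1) (e 0) + B (e 1) (e 0) (e 0))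
    (B (e 1) (e 1) (e 0) + B (e 1) (e 0) (e 1) + B (e 0) (e 1) (e 1)) (B (e 1) (e 1) (e 1)) (by
      intro x y hx hy hz
      by_contra hcon
      obtain ⟨w, hw⟩ := hsm (x • e 0 + y • e 1)
        (fun h0 => hcon (by
          have := hind x y 0 0 (by simpa using h0)
          exact ⟨this.1, this.2.1⟩))
        (by
          simp only [map_add, map_smul, LinearMap.add_apply, LinearMap.smul_apply, smul_eq_mul]
          linear_combination hz)
      apply hw
      have key := hb' (x • e 0 + y • e 1) (q w) (by simp [q0, q1]) (hpq0 w)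
      rw [← e.sum_equivFun w] at key ⊢
      simp only [Fin.sum_univ_four, map_add, map_smul, LinearMap.add_apply, LinearMap.smul_apply,
        smul_eq_mul, q0, q1, q2, q3, map_zero, LinearMap.zero_apply] at key ⊢
      linear_combination key + e.equivFun w 0 * hx + e.equivFun w 1 * hy)
  obtain ⟨c1, c2, d1, d2, hd2, hs2⟩ := aux_bin hchar (m / l) hom (B (e 2) (e 2) (e 2))
    (B (e 2) (e 2) (e 3) + B (e 2) (e 3) (e 2) + B (e 3) (e 2) (e 2))
    (B (e 3) (e 3) (e 2) + B (e 3) (e 2) (e 3) + B (e 2) (e 3) (e 3)) (B (e 3) (e 3) (e 3)) (by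
      intro x y hx hy hz
      by_contra hcon
      obtain ⟨w, hw⟩ := hsm (x • e 2 + y • e 3)
        (fun h0 => hcon (by
          have := hind 0 0 x y (by simpa using h0)
          exact ⟨this.2.2.1, this.2.2.2⟩))
        (by
          simp only [map_add, map_smul, LinearMap.add_apply, LinearMap.smul_apply, smul_eq_mul]
          linear_combination hz)
      apply hw
      have key := hc' (p w) (x • e 2 + y • e 3) (hqp0 w) (by simp [p2, p3])
      rw [← e.sum_equivFun w] at key ⊢
      simp only [Fin.sum_univ_four, map_add, map_smul, LinearMap.add_apply, LinearMap.smul_apply,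
        smul_eq_mul, p0, p1, p2, p3, map_zero, LinearMap.zero_apply] at key ⊢
      linear_combination key + e.equivFun w 2 * hx + e.equivFun w 3 * hy)
  let M : Matrix (Fin 4) (Fin 4) F := !![a1, a2, 0, 0; b1, b2, 0, 0; 0, 0, c1, c2; 0, 0, d1, d2]
  have hM : IsUnit M.det := by
    have : M.det = (a1 * b2 - a2 * b1) * (c1 * d2 - c2 * d1) := by
      simp [M, Matrix.det_succ_row_zero, Fin.sum_univ_succ, Fin.succAbove]
      ring
    rw [this]
    exact (mul_ne_zero hd1 hd2).isUnit
  refine ⟨e.equivFun.trans (Matrix.toLinearEquiv' M (Matrix.invertibleOfIsUnitDet M hM)), fun v => ?_⟩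
  have hg : ∀ i, (e.equivFun.trans (Matrix.toLinearEquiv' M (Matrix.invertibleOfIsUnitDet M hM))) v i
      = M.mulVec (e.equivFun v) i := fun i => rfl
  simp only [hg]
  have hv : v = (e.equivFun v 0 • e 0 + e.equivFun v 1 • e 1) +
      (e.equivFun v 2 • e 2 + e.equivFun v 3 • e 3) := by
    conv_lhs => rw [← e.sum_equivFun v]
    rw [Fin.sum_univ_four]
    abel
  generalize e.equivFun v = z at *
  have k1 := hb' (z 0 • e 0 + z 1 • e 1) (z 2 • e 2 + z 3 • e 3) (by simp [q0, q1])
    (by simp [p2, p3])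
  have k2 := hc' (z 0 • e 0 + z 1 • e 1) (z 2 • e 2 + z 3 • e 3) (by simp [q0, q1])
    (by simp [p2, p3])
  have s1 := hs1 (z 0) (z 1)
  have s2 := hs2 (z 2) (z 3)
  have m0 : M.mulVec z 0 = a1 * z 0 + a2 * z 1 := by
    simp [M, Matrix.mulVec, dotProduct, Fin.sum_univ_four]
  have m1 : M.mulVec z 1 = b1 * z 0 + b2 * z 1 := by
    simp [M, Matrix.mulVec, dotProduct, Fin.sum_univ_four]
  have m2 : M.mulVec z 2 = c1 * z 2 + c2 * z 3 := by
    simp [M, Matrix.mulVec, dotProduct, Fin.sum_univ_four]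
  have m3 : M.mulVec z 3 = d1 * z 2 + d2 * z 3 := by
    simp [M, Matrix.mulVec, dotProduct, Fin.sum_univ_four]
  rw [m0, m1, m2, m3, add_assoc, ← s1, ← s2]
  have hB : B v v v = B (z 0 • e 0 + z 1 • e 1) (z 0 • e 0 + z 1 • e 1) (z 0 • e 0 + z 1 • e 1)
      + B (z 2 • e 2 + z 3 • e 3) (z 2 • e 2 + z 3 • e 3) (z 2 • e 2 + z 3 • e 3) := by
    generalize z 0 • e 0 + z 1 • e 1 = x at *
    generalize z 2 • e 2 + z 3 • e 3 = y at *
    rw [hv]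
    simp only [map_add, LinearMap.add_apply]
    linear_combination k1 + k2
  rw [hB]
  simp only [map_add, map_smul, LinearMap.add_apply, LinearMap.smul_apply, smul_eq_mul]
  ring

/-- Let `F` be an algebraically closed field of characteristic not `3`, `f` a homogeneous
cubic in four variables cutting out a smooth cubic surface, and `W₁, …, W₆` six pairwise skew
lines on it. If `t ∈ GL₄(F)` maps the affine cone `{f = 0}` onto itself, fixes `W₁, W₂, W₃`
and cyclically permutes `W₄ ↦ W₅ ↦ W₆ ↦ W₄`, then the surface is isomorphic to the Fermat
cubic: some `g ∈ GL₄(F)` maps `{f = 0}` onto `{v₀³ + v₁³ + v₂³ + v₃³ = 0}`. -/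
theorem stmt_13 (F : Type*) [Field F] [IsAlgClosed F]
    (hchar : (3 : F) ≠ 0)
    (f : MvPolynomial (Fin 4) F) (hf : f.IsHomogeneous 3)
    (hsmooth : ¬ ∃ v : Fin 4 → F, v ≠ 0 ∧ eval v f = 0 ∧ ∀ i, eval v (pderiv i f) = 0)
    (W : Fin 6 → Submodule F (Fin 4 → F))
    (hdim : ∀ i, Module.finrank F (W i) = 2)
    (hskew : ∀ i j, i ≠ j → W i ⊓ W j = ⊥)
    (hlines : ∀ i, ∀ w ∈ W i, eval w f = 0)
    (t : (Matrix (Fin 4) (Fin 4) F)ˣ)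
    (htS : (Matrix.mulVecLin (t : Matrix (Fin 4) (Fin 4) F)) ''
        {v : Fin 4 → F | eval v f = 0} = {v : Fin 4 → F | eval v f = 0})
    (ht1 : (W 0).map (Matrix.mulVecLin (t : Matrix (Fin 4) (Fin 4) F)) = W 0)
    (ht2 : (W 1).map (Matrix.mulVecLin (t : Matrix (Fin 4) (Fin 4) F)) = W 1)
    (ht3 : (W 2).map (Matrix.mulVecLin (t : Matrix (Fin 4) (Fin 4) F)) = W 2)
    (ht4 : (W 3).map (Matrix.mulVecLin (t : Matrix (Fin 4) (Fin 4) F)) = W 4)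
    (ht5 : (W 4).map (Matrix.mulVecLin (t : Matrix (Fin 4) (Fin 4) F)) = W 5)
    (ht6 : (W 5).map (Matrix.mulVecLin (t : Matrix (Fin 4) (Fin 4) F)) = W 3) :
    ∃ g : (Matrix (Fin 4) (Fin 4) F)ˣ,
      (Matrix.mulVecLin (g : Matrix (Fin 4) (Fin 4) F)) '' {v : Fin 4 → F | eval v f = 0} =
        {v : Fin 4 → F | v 0 ^ 3 + v 1 ^ 3 + v 2 ^ 3 + v 3 ^ 3 = 0} := by
  obtain ⟨B, hB, hB'⟩ := aux_tri f hf
  have hmap : ∀ {A C : Submodule F (Fin 4 → F)},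
      A.map (Matrix.mulVecLin (t : Matrix (Fin 4) (Fin 4) F)) = C →
      ∀ x ∈ A, Matrix.mulVecLin (t : Matrix (Fin 4) (Fin 4) F) x ∈ C := by
    rintro A C rfl x hx
    exact Submodule.mem_map_of_mem hx
  have hinj : Function.Injective (Matrix.mulVecLin (t : Matrix (Fin 4) (Fin 4) F)) :=
    Matrix.mulVec_injective_of_isUnit t.isUnit
  obtain ⟨l, m, e, hl, hm, hlm, h3, h0, h1, h2, h4⟩ := aux_lin hchar W hdim hskew
    (Matrix.mulVecLin (t : Matrix (Fin 4) (Fin 4) F)) hinj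
    (hmap ht1) (hmap ht2) (hmap ht3) (hmap ht4) (hmap ht5) (hmap ht6)
  have hsm : ∀ v, v ≠ 0 → B v v v = 0 → ∃ w, B w v v + B v w v + B v v w ≠ 0 := by
    intro v hv h0
    by_contra hcon
    push Not at hcon
    refine hsmooth ⟨v, hv, by rw [hB, h0], fun i => ?_⟩
    have := hcon (Pi.single i 1)
    rw [hB'] at this
    simpa [Pi.single_apply] using this
  have hT : ∀ v, B v v v = 0 → B (Matrix.mulVecLin (t : Matrix (Fin 4) (Fin 4) F) v)
      (Matrix.mulVecLin (t : Matrix (Fin 4) (Fin 4) F) v)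
      (Matrix.mulVecLin (t : Matrix (Fin 4) (Fin 4) F) v) = 0 := by
    intro v hv
    have : Matrix.mulVecLin (t : Matrix (Fin 4) (Fin 4) F) v ∈ {v : Fin 4 → F | eval v f = 0} := by
      rw [← htS]
      exact ⟨v, by rw [Set.mem_ofPred_eq, hB, hv], rfl⟩
    rwa [Set.mem_ofPred_eq, hB] at this
  obtain ⟨g, hg⟩ := aux_core hchar B hsm _ hT l m e hl hm hlm h3 h0 h1 h2 h4
  have e1 : LinearMap.toMatrix' g.toLinearMap * LinearMap.toMatrix' g.symm.toLinearMap = 1 := by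
    rw [← LinearMap.toMatrix'_comp]; simp
  have e2 : LinearMap.toMatrix' g.symm.toLinearMap * LinearMap.toMatrix' g.toLinearMap = 1 := by
    rw [← LinearMap.toMatrix'_comp]; simp
  refine ⟨⟨_, _, e1, e2⟩, ?_⟩
  have hgm : ∀ v, Matrix.mulVecLin (LinearMap.toMatrix' g.toLinearMap) v = g v := by
    intro v
    rw [Matrix.mulVecLin_apply, LinearMap.toMatrix'_mulVec]
    rfl
  ext v
  simp only [Set.mem_image, Set.mem_ofPred_eq, hgm, hB, hg]
  constructor
  · rintro ⟨x, hx, rfl⟩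
    exact hx
  · intro hv
    exact ⟨g.symm v, by simpa using hv, by simp⟩
end

section
/- Let F be an algebraically closed field of characteristic different from 2 and 3, and fix a primitive cube root of unity ω ∈ F. Let S = {[v] ∈ ℙ³(F) : v₀³ + v₁³ + v₂³ + v₃³ = 0} be the Fermat cubic surface and Aut(S) the subgroup of PGL₄(F) = GL₄(F)/F^× consisting of elements mapping S onto itself. Then Aut(S) contains exactly 6 elements of type A₂, i.e., exactly 6 elements admitting a lift in GL₄(F) whose characteristic polynomial is (X−1)²(X−ω)² or (X−1)²(X−ω²)²; moreover these 6 elements pairwise commute. -/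
open Polynomial

/-- The subgroup of nonzero scalar matrices in `GL₄(F)`; the quotient by it is `PGL₄(F)`. -/
def scalarUnits (F : Type*) [Field F] : Subgroup (Matrix (Fin 4) (Fin 4) F)ˣ where
  carrier := {g | ∃ c : F, (g : Matrix (Fin 4) (Fin 4) F) = c • (1 : Matrix (Fin 4) (Fin 4) F)}
  one_mem' := ⟨1, by simp⟩
  mul_mem' := by
    rintro a b ⟨c, hc⟩ ⟨d, hd⟩
    exact ⟨c * d, by rw [Units.val_mul, hc, hd, smul_mul_smul_comm, one_mul]⟩
  inv_mem' := by
    rintro a ⟨c, hc⟩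
    have hc0 : c ≠ 0 := by
      rintro rfl
      have h1 : ((a : Matrix (Fin 4) (Fin 4) F)) * ((a⁻¹ : (Matrix (Fin 4) (Fin 4) F)ˣ) :
          Matrix (Fin 4) (Fin 4) F) = 1 := Units.mul_inv _
      rw [hc] at h1
      simp at h1
    refine ⟨c⁻¹, Units.inv_eq_of_mul_eq_one_right ?_⟩
    rw [hc, smul_mul_smul_comm, one_mul, mul_inv_cancel₀ hc0, one_smul]

instance scalarUnits_normal (F : Type*) [Field F] : (scalarUnits F).Normal := by
  constructor
  rintro n ⟨c, hc⟩ g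
  refine ⟨c, ?_⟩
  rw [Units.val_mul, Units.val_mul, hc, mul_smul_comm, mul_one, smul_mul_assoc,
    Units.mul_inv]

/-- The projective general linear group `PGL₄(F) = GL₄(F)/F^×`. -/
abbrev PGL4 (F : Type*) [Field F] := (Matrix (Fin 4) (Fin 4) F)ˣ ⧸ scalarUnits F

/-- The affine cone over the Fermat cubic surface `S ⊂ ℙ³(F)`. -/
def fermatCone (F : Type*) [Field F] : Set (Fin 4 → F) :=
  {v | v 0 ^ 3 + v 1 ^ 3 + v 2 ^ 3 + v 3 ^ 3 = 0}

/-- A matrix `g ∈ GL₄(F)` induces an automorphism of the Fermat cubic surface iff it maps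
the affine cone over it onto itself. -/
def PreservesFermat {F : Type*} [Field F] (g : (Matrix (Fin 4) (Fin 4) F)ˣ) : Prop :=
  (Matrix.mulVecLin (g : Matrix (Fin 4) (Fin 4) F)) '' fermatCone F = fermatCone F

/-- The automorphism group `Aut(S) ⊆ PGL₄(F)` of the Fermat cubic surface `S`. -/
def autFermat (F : Type*) [Field F] : Subgroup (PGL4 F) where
  carrier := {x | ∃ g, QuotientGroup.mk g = x ∧ PreservesFermat g}
  one_mem' := by
    refine ⟨1, rfl, ?_⟩
    simp [PreservesFermat]
  mul_mem' := by
    rintro x y ⟨g, rfl, hg⟩ ⟨h, rfl, hh⟩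
    refine ⟨g * h, rfl, ?_⟩
    unfold PreservesFermat at *
    rw [Units.val_mul, Matrix.mulVecLin_mul, LinearMap.coe_comp, Set.image_comp, hh, hg]
  inv_mem' := by
    rintro x ⟨g, rfl, hg⟩
    refine ⟨g⁻¹, rfl, ?_⟩
    unfold PreservesFermat at *
    conv_lhs => rw [← hg, ← Set.image_comp, ← LinearMap.coe_comp, ← Matrix.mulVecLin_mul,
      ← Units.val_mul, inv_mul_cancel]
    simp

/-- An element of `PGL₄(F)` is of type `A₂` if some lift in `GL₄(F)` has characteristic
polynomial `(X−1)²(X−ω)²` or `(X−1)²(X−ω²)²`, i.e. eigenvalues `1, 1, ω, ω` up to a common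
scalar. -/
def TypeA2 {F : Type*} [Field F] (ω : F) (x : PGL4 F) : Prop :=
  ∃ g : (Matrix (Fin 4) (Fin 4) F)ˣ, QuotientGroup.mk g = x ∧
    ((g : Matrix (Fin 4) (Fin 4) F).charpoly = (X - 1) ^ 2 * (X - C ω) ^ 2 ∨
      (g : Matrix (Fin 4) (Fin 4) F).charpoly = (X - 1) ^ 2 * (X - C (ω ^ 2)) ^ 2)

section Helpers

variable {F : Type*} [Field F]

/-- The Fermat cubic form. -/
def ferm (v : Fin 4 → F) : F := v 0 ^ 3 + v 1 ^ 3 + v 2 ^ 3 + v 3 ^ 3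

lemma coeffs_zero (h3 : (3 : F) ≠ 0) {ω : F} (hω3 : ω ^ 3 = 1) (hω : ω ≠ 1) {A B C D d : F}
    (hd : d ≠ 0)
    (h1 : A + B * d + C * d ^ 2 + D * d ^ 3 = 0)
    (h2 : A + B * (ω * d) + C * (ω * d) ^ 2 + D * (ω * d) ^ 3 = 0)
    (h4 : A + B * (ω ^ 2 * d) + C * (ω ^ 2 * d) ^ 2 + D * (ω ^ 2 * d) ^ 3 = 0) :
    A + D * d ^ 3 = 0 ∧ B = 0 ∧ C = 0 := by
  have hq : ω ^ 2 + ω + 1 = 0 := by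
    have : (ω - 1) * (ω ^ 2 + ω + 1) = 0 := by linear_combination hω3
    exact (mul_eq_zero.1 this).resolve_left (sub_ne_zero.2 hω)
  refine ⟨?_, ?_, ?_⟩
  · apply (mul_eq_zero.1 (_ : (3 : F) * (A + D * d ^ 3) = 0)).resolve_left h3
    have e6 : ω ^ 6 = 1 := by linear_combination (ω ^ 3 + 1) * hω3
    have e4 : ω ^ 4 = ω := by linear_combination ω * hω3
    linear_combination h1 + h2 + h4 - D * d ^ 3 * (hω3 + e6) - B * d * hq - C * d ^ 2 * hq
      - C * d ^ 2 * e4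
  · apply (mul_eq_zero.1 (_ : (3 * d : F) * B = 0)).resolve_left (mul_ne_zero h3 hd)
    have e8 : ω ^ 8 = ω ^ 2 := by linear_combination (ω ^ 5 + ω ^ 2) * hω3
    have e7 : ω ^ 7 = ω := by linear_combination (ω ^ 4 + ω) * hω3
    have e5 : ω ^ 5 = ω ^ 2 := by linear_combination (ω ^ 2) * hω3
    have e4 : ω ^ 4 = ω := by linear_combination ω * hω3
    linear_combination h1 + ω ^ 2 * h2 + ω * h4 - A * hq - 2 * B * d * hω3
      - C * d ^ 2 * (e4 + e5 + hq) - D * d ^ 3 * (e5 + e7 + hq)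
  · apply (mul_eq_zero.1 (_ : (3 * d ^ 2 : F) * C = 0)).resolve_left
      (mul_ne_zero h3 (pow_ne_zero 2 hd))
    have e8 : ω ^ 8 = ω ^ 2 := by linear_combination (ω ^ 5 + ω ^ 2) * hω3
    have e6 : ω ^ 6 = 1 := by linear_combination (ω ^ 3 + 1) * hω3
    have e4 : ω ^ 4 = ω := by linear_combination ω * hω3
    linear_combination h1 + ω * h2 + ω ^ 2 * h4 - A * hq
      - B * d * (e4 + hq) - C * d ^ 2 * (hω3 + e6) - D * d ^ 3 * (e4 + e8 + hq)

/-- A linear map sending the Fermat cone into itself scales the Fermat form, generic case. -/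
lemma scale_generic [IsAlgClosed F] (h3 : (3 : F) ≠ 0) {ω : F} (hω3 : ω ^ 3 = 1) (hω : ω ≠ 1)
    (g : Matrix (Fin 4) (Fin 4) F)
    (hg : ∀ v, ferm v = 0 → ferm (g.mulVec v) = 0) (a b c t : F)
    (hne : a ^ 3 + b ^ 3 + c ^ 3 ≠ 0) :
    ferm (g.mulVec ![a, b, c, t]) = ferm (fun i => g i 3) * ferm ![a, b, c, t] := by
  obtain ⟨d, hd⟩ := IsAlgClosed.exists_pow_nat_eq (-(a ^ 3 + b ^ 3 + c ^ 3)) (n := 3) (by norm_num)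
  have hd0 : d ≠ 0 := by
    rintro rfl
    apply hne
    rw [← neg_eq_zero, ← hd]; ring
  set p : Fin 4 → F := fun i => g i 0 * a + g i 1 * b + g i 2 * c with hp
  have key : ∀ s, ferm (g.mulVec ![a, b, c, s]) =
      (p 0 ^ 3 + p 1 ^ 3 + p 2 ^ 3 + p 3 ^ 3) +
      (3 * (p 0 ^ 2 * g 0 3 + p 1 ^ 2 * g 1 3 + p 2 ^ 2 * g 2 3 + p 3 ^ 2 * g 3 3)) * s +
      (3 * (p 0 * g 0 3 ^ 2 + p 1 * g 1 3 ^ 2 + p 2 * g 2 3 ^ 2 + p 3 * g 3 3 ^ 2)) * s ^ 2 +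
      ferm (fun i => g i 3) * s ^ 3 := by
    intro s
    have hm : ∀ i, g.mulVec ![a, b, c, s] i = p i + g i 3 * s := by
      intro i
      simp [Matrix.mulVec, dotProduct, Fin.sum_univ_four, hp]
    simp only [ferm, hm]
    ring
  have hv : ∀ s, s ^ 3 = -(a ^ 3 + b ^ 3 + c ^ 3) → ferm (g.mulVec ![a, b, c, s]) = 0 := by
    intro s hs
    apply hg
    simp [ferm, hs]
  have e1 := hv d hd
  have e2 := hv (ω * d) (by rw [mul_pow, hω3, hd, one_mul])
  have e3 := hv (ω ^ 2 * d) (by rw [mul_pow, hd, ← pow_mul, mul_comm 2 3, pow_mul, hω3]; simp)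
  rw [key] at e1 e2 e3
  obtain ⟨k1, k2, k3⟩ := coeffs_zero h3 hω3 hω hd0 e1 e2 e3
  rw [key, k2, k3]
  have hf : ferm ![a, b, c, t] = a ^ 3 + b ^ 3 + c ^ 3 + t ^ 3 := by simp [ferm]
  rw [hf]
  linear_combination k1 - ferm (fun i => g i 3) * hd

lemma scale_all [IsAlgClosed F] (h3 : (3 : F) ≠ 0) {ω : F} (hω3 : ω ^ 3 = 1) (hω : ω ≠ 1)
    (g : Matrix (Fin 4) (Fin 4) F)
    (hg : ∀ v, ferm v = 0 → ferm (g.mulVec v) = 0) (v : Fin 4 → F) :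
    ferm (g.mulVec v) = ferm (fun i => g i 3) * ferm v := by
  have hv : v = ![v 0, v 1, v 2, v 3] := by ext i; fin_cases i <;> rfl
  set L := ferm (fun i => g i 3) with hL
  set r := g.mulVec v with hr
  let Q : F[X] := (C (r 0) + C (g 0 0) * X) ^ 3 + (C (r 1) + C (g 1 0) * X) ^ 3 +
    (C (r 2) + C (g 2 0) * X) ^ 3 + (C (r 3) + C (g 3 0) * X) ^ 3 -
    C L * ((C (v 0) + X) ^ 3 + C (v 1 ^ 3 + v 2 ^ 3 + v 3 ^ 3))
  let R : F[X] := (C (v 0) + X) ^ 3 + C (v 1 ^ 3 + v 2 ^ 3)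
  have hR : R ≠ 0 := by
    intro h0
    have h1 : R.eval (-v 0) = 0 := by rw [h0]; simp
    have h2 : R.eval (1 - v 0) = 0 := by rw [h0]; simp
    simp only [R, eval_add, eval_pow, eval_C, eval_X] at h1 h2
    have : (1 : F) = 0 := by linear_combination h2 - h1
    exact one_ne_zero this
  have hQR : Q * R = 0 := by
    have : Infinite F := IsAlgClosed.instInfinite
    apply Polynomial.funext
    intro s
    rw [eval_mul, eval_zero]
    by_cases hs : (v 0 + s) ^ 3 + v 1 ^ 3 + v 2 ^ 3 = 0
    · have : R.eval s = 0 := by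
        simp only [R, eval_add, eval_pow, eval_C, eval_X]
        linear_combination hs
      rw [this, mul_zero]
    · have h := scale_generic h3 hω3 hω g hg (v 0 + s) (v 1) (v 2) (v 3) hs
      have hm : ∀ i, g.mulVec ![v 0 + s, v 1, v 2, v 3] i = r i + g i 0 * s := by
        intro i
        simp [Matrix.mulVec, dotProduct, Fin.sum_univ_four, hr]
        ring
      have : Q.eval s = 0 := by
        rw [← hL] at h
        simp only [ferm, hm] at h
        simp at h
        simp only [Q, eval_add, eval_sub, eval_mul, eval_pow, eval_C, eval_X]
        linear_combination h
      rw [this, zero_mul]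
  have hQ : Q = 0 := (mul_eq_zero.1 hQR).resolve_right hR
  have h0 : Q.eval 0 = 0 := by rw [hQ]; simp
  simp only [Q, eval_add, eval_sub, eval_mul, eval_pow, eval_C, eval_X] at h0
  simp only [ferm]
  linear_combination h0

/-- The symmetric trilinear form of the Fermat cubic. -/
def tri (u v w : Fin 4 → F) : F :=
  u 0 * v 0 * w 0 + u 1 * v 1 * w 1 + u 2 * v 2 * w 2 + u 3 * v 3 * w 3

lemma tri_eq (u v w : Fin 4 → F) : 6 * tri u v w =
    ferm (u + v + w) - ferm (u + v) - ferm (u + w) - ferm (v + w)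
      + ferm u + ferm v + ferm w := by
  simp only [ferm, tri, Pi.add_apply]
  ring

lemma rows_disjoint (h6 : (6 : F) ≠ 0) (g : (Matrix (Fin 4) (Fin 4) F)ˣ) (L : F)
    (h : ∀ v, ferm ((g : Matrix (Fin 4) (Fin 4) F).mulVec v) = L * ferm v)
    (i j k : Fin 4) (hjk : j ≠ k) :
    (g : Matrix (Fin 4) (Fin 4) F) i j * (g : Matrix (Fin 4) (Fin 4) F) i k = 0 := by
  set G := (g : Matrix (Fin 4) (Fin 4) F) with hG
  have ht : ∀ u v w, tri (G.mulVec u) (G.mulVec v) (G.mulVec w) = L * tri u v w := by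
    intro u v w
    apply mul_left_cancel₀ h6
    rw [tri_eq, ← Matrix.mulVec_add, ← Matrix.mulVec_add, ← Matrix.mulVec_add,
      ← Matrix.mulVec_add]
    simp only [h]
    linear_combination -L * tri_eq u v w
  have hs := ht (Pi.single j 1) (Pi.single k 1)
    (((g⁻¹ : (Matrix (Fin 4) (Fin 4) F)ˣ) : Matrix (Fin 4) (Fin 4) F).mulVec (Pi.single i 1))
  rw [Matrix.mulVec_mulVec, Units.mul_inv, Matrix.one_mulVec, Matrix.mulVec_single_one,
    Matrix.mulVec_single_one] at hs
  have hz : ∀ w : Fin 4 → F, tri (Pi.single j 1) (Pi.single k 1) w = 0 := by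
    intro w
    fin_cases j <;> fin_cases k <;> simp [tri] at hjk ⊢
  rw [hz, mul_zero] at hs
  fin_cases i <;> simpa [tri] using hs

set_option maxRecDepth 20000 in
lemma perm3 : ∀ σ : Fin 4 → Fin 4, (∀ i, σ (σ (σ i)) = i) →
    (∀ i, σ i = i) ∨ ∃ k, σ k = k ∧ ∀ j, j ≠ k → σ j ≠ j := by decide

/-- Monomial matrices with the given characteristic polynomial are diagonal with entries
`1, 1, η, η`. -/
lemma monomial_class [IsAlgClosed F] (h2 : (2 : F) ≠ 0) (h3 : (3 : F) ≠ 0) {η : F}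
    (hη3 : η ^ 3 = 1) (hη : η ≠ 1) (g : (Matrix (Fin 4) (Fin 4) F)ˣ)
    (hd : ∀ i j k : Fin 4, j ≠ k →
      (g : Matrix (Fin 4) (Fin 4) F) i j * (g : Matrix (Fin 4) (Fin 4) F) i k = 0)
    (hc : (g : Matrix (Fin 4) (Fin 4) F).charpoly = (X - 1) ^ 2 * (X - C η) ^ 2) :
    ∃ d : Fin 4 → F, (g : Matrix (Fin 4) (Fin 4) F) = Matrix.diagonal d ∧
      (∀ i, d i = 1 ∨ d i = η) ∧ d 0 + d 1 + d 2 + d 3 = 2 + 2 * η := by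
  have hGu : IsUnit (g : Matrix (Fin 4) (Fin 4) F) := g.isUnit
  set G := (g : Matrix (Fin 4) (Fin 4) F) with hG
  have hrow : ∀ i, ∃ j, G i j ≠ 0 := by
    intro i
    by_contra! hcon
    have h1 : (G * ((g⁻¹ : (Matrix (Fin 4) (Fin 4) F)ˣ) : Matrix (Fin 4) (Fin 4) F)) i i = 1 := by
      rw [hG, Units.mul_inv]; simp
    rw [Matrix.mul_apply] at h1
    simp [hcon] at h1
  choose σ hσ using hrow
  set d : Fin 4 → F := fun i => G i (σ i) with hdd
  have hGe : ∀ i j, G i j = if j = σ i then d i else 0 := by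
    intro i j
    split_ifs with hj
    · rw [hj]
    · exact (mul_eq_zero.1 (hd i j (σ i) hj)).resolve_right (hσ i)
  have hmul : ∀ (A : Matrix (Fin 4) (Fin 4) F) i j, (G * A) i j = d i * A (σ i) j := by
    intro A i j
    rw [Matrix.mul_apply]
    simp [hGe]
  have hsurj : Function.Surjective σ := by
    intro k
    by_contra! hcon
    have h1 : (((g⁻¹ : (Matrix (Fin 4) (Fin 4) F)ˣ) : Matrix (Fin 4) (Fin 4) F) * G) k k = 1 := by
      rw [hG, Units.inv_mul]; simp
    rw [Matrix.mul_apply] at h1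
    simp [hGe, fun i => (hcon i).symm] at h1
  have hinj : Function.Injective σ := Finite.injective_iff_surjective.2 hsurj
  have htr : G.trace = 2 + 2 * η := by
    rw [Matrix.trace_eq_sum_roots_charpoly, hc, roots_mul, roots_pow, roots_pow, ← C_1,
      roots_X_sub_C, roots_X_sub_C]
    · simp [two_nsmul, Multiset.sum_add]
      ring
    · apply mul_ne_zero <;> apply pow_ne_zero
      · rw [← C_1]; exact X_sub_C_ne_zero _
      · exact X_sub_C_ne_zero _
  have htr' : G.trace = (if σ 0 = 0 then d 0 else 0) + (if σ 1 = 1 then d 1 else 0) +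
      (if σ 2 = 2 then d 2 else 0) + (if σ 3 = 3 then d 3 else 0) := by
    rw [Matrix.trace, Fin.sum_univ_four]
    simp [hGe, eq_comm]
  have hq : η ^ 2 + η + 1 = 0 := by
    have : (η - 1) * (η ^ 2 + η + 1) = 0 := by linear_combination hη3
    exact (mul_eq_zero.1 this).resolve_left (sub_ne_zero.2 hη)
  have hCH : (G ^ 3 - 1) ^ 2 = 0 := by
    have h1 : aeval G ((X ^ 3 - 1 : F[X]) ^ 2) = 0 := by
      have hfac : (X ^ 3 - 1 : F[X]) ^ 2 = G.charpoly * (X - C (η ^ 2)) ^ 2 := by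
        have hqC : (C η : F[X]) ^ 2 + C η + 1 = 0 := by
          rw [← C_1, ← C_pow, ← C_add, ← C_add, hq, C_0]
        have : (X ^ 3 - 1 : F[X]) = (X - 1) * (X - C η) * (X - C (η ^ 2)) := by
          rw [C_pow]
          linear_combination (X ^ 2 - X) * hqC + (1 - X) * (C η - 1) * hqC
        rw [this, hc]
        ring
      rw [hfac, map_mul, Matrix.aeval_self_charpoly, zero_mul]
    simpa using h1
  -- the cube of `G` is the identity
  set τ : Fin 4 → Fin 4 := fun i => σ (σ (σ i)) with hτ
  set m : Fin 4 → F := fun i => d i * (d (σ i) * d (σ (σ i))) with hm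
  have hM : ∀ i j, (G ^ 3) i j = if j = τ i then m i else 0 := by
    intro i j
    rw [show G ^ 3 = G * (G * G) by noncomm_ring, hmul, hmul, hGe]
    split_ifs <;> simp [hm]
  have hMM : ∀ i j, m i * (G ^ 3) (τ i) j - 2 * (G ^ 3) i j +
      (1 : Matrix (Fin 4) (Fin 4) F) i j = 0 := by
    intro i j
    have h1 : (G ^ 3) * (G ^ 3) - (2 : F) • G ^ 3 + 1 = 0 := by
      rw [← hCH, two_smul]; noncomm_ring
    have h5 := congrFun (congrFun h1 i) j
    rw [Matrix.add_apply, Matrix.sub_apply, Matrix.smul_apply, Matrix.mul_apply] at h5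
    simpa [hM i] using h5
  have hmne : ∀ i, m i ≠ 0 := fun i => mul_ne_zero (hσ _) (mul_ne_zero (hσ _) (hσ _))
  have hτid : ∀ i, τ i = i := by
    intro i
    by_contra hne
    have hne' : τ i ≠ τ (τ i) := fun h => hne (hinj (hinj (hinj h))).symm
    have h5 := hMM i (τ i)
    rw [hM, hM, if_neg hne', if_pos rfl, Matrix.one_apply_ne (Ne.symm hne)] at h5
    have : 2 * m i = 0 := by linear_combination -h5
    exact mul_ne_zero h2 (hmne i) this
  have hm1 : ∀ i, m i = 1 := by
    intro i
    have h5 := hMM i i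
    rw [hM, hM, hτid, hτid, if_pos rfl, Matrix.one_apply_eq] at h5
    have : (m i - 1) ^ 2 = 0 := by linear_combination h5
    exact sub_eq_zero.1 (pow_eq_zero_iff (two_ne_zero) |>.1 this)
  rcases perm3 σ hτid with hid | ⟨k, hk, hother⟩
  · have hdiag : G = Matrix.diagonal d := by
      ext i j
      rw [hGe, hid, Matrix.diagonal_apply]
      simp [eq_comm]
    refine ⟨d, hdiag, ?_, ?_⟩
    · intro i
      have h5 : G.charpoly.eval (d i) = 0 := by
        rw [hdiag, Matrix.charpoly_diagonal, eval_prod]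
        exact Finset.prod_eq_zero (Finset.mem_univ i) (by simp)
      rw [hc] at h5
      simpa [sub_eq_zero] using h5
    · rw [← htr, htr']
      simp [hid]
  · exfalso
    have h5 : G.trace = d k := by
      have h7 : ∀ j, (if σ j = j then d j else 0) = if j = k then d k else 0 := by
        intro j
        by_cases hj : j = k
        · rw [if_pos hj, hj, if_pos hk]
        · rw [if_neg hj, if_neg (hother j hj)]
      rw [htr', h7, h7, h7, h7]
      clear_value d
      clear * -
      fin_cases k <;> simp
    have h6 : d k ^ 3 = 1 := by
      rw [← hm1 k]
      simp only [hm, hk]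
      ring
    rw [← h5, htr] at h6
    have : (3 : F) * 3 = 0 := by
      linear_combination (-1 : F) * h6 + (8 * η + 16) * hq
    exact mul_ne_zero h3 h3 this

/-- The diagonal unit attached to a set of coordinates. -/
def dunit (ω : F) (h : ω ≠ 0) (t : Finset (Fin 4)) : (Matrix (Fin 4) (Fin 4) F)ˣ where
  val := Matrix.diagonal fun i => if i ∈ t then ω else 1
  inv := Matrix.diagonal fun i => if i ∈ t then ω⁻¹ else 1
  val_inv := by
    rw [Matrix.diagonal_mul_diagonal, ← Matrix.diagonal_one]
    congr 1; ext i; split_ifs <;> simp [h]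
  inv_val := by
    rw [Matrix.diagonal_mul_diagonal, ← Matrix.diagonal_one]
    congr 1; ext i; split_ifs <;> simp [h]

lemma mk_eq_iff (g h : (Matrix (Fin 4) (Fin 4) F)ˣ) :
    (QuotientGroup.mk g : PGL4 F) = QuotientGroup.mk h ↔
      ∃ c : F, (h : Matrix (Fin 4) (Fin 4) F) = c • (g : Matrix (Fin 4) (Fin 4) F) := by
  rw [QuotientGroup.eq]
  constructor
  · rintro ⟨c, hc⟩
    refine ⟨c, ?_⟩
    have : (h : Matrix (Fin 4) (Fin 4) F) = g * (g⁻¹ * h : (Matrix (Fin 4) (Fin 4) F)ˣ) := by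
      rw [← Units.val_mul, mul_inv_cancel_left]
    rw [this, hc]
    simp
  · rintro ⟨c, hc⟩
    refine ⟨c, ?_⟩
    rw [Units.val_mul, hc, mul_smul_comm, Units.inv_mul]

lemma preserves_maps {g : (Matrix (Fin 4) (Fin 4) F)ˣ} (hg : PreservesFermat g)
    (v : Fin 4 → F) (hv : ferm v = 0) :
    ferm ((g : Matrix (Fin 4) (Fin 4) F).mulVec v) = 0 := by
  have : (Matrix.mulVecLin (g : Matrix (Fin 4) (Fin 4) F)) v ∈ fermatCone F := by
    rw [← hg]
    exact ⟨v, hv, rfl⟩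
  exact this

lemma dunit_ferm {ω : F} (hω3 : ω ^ 3 = 1) (h : ω ≠ 0) (t : Finset (Fin 4)) (v : Fin 4 → F) :
    ferm ((dunit ω h t : Matrix (Fin 4) (Fin 4) F).mulVec v) = ferm v := by
  have hm : ∀ i, ((dunit ω h t : Matrix (Fin 4) (Fin 4) F).mulVec v i) ^ 3 = v i ^ 3 := by
    intro i
    simp only [dunit, Matrix.mulVec_diagonal]
    split_ifs <;> simp [mul_pow, hω3]
  simp only [ferm, hm]

lemma dunit_preserves {ω : F} (hω3 : ω ^ 3 = 1) (h : ω ≠ 0) (t : Finset (Fin 4)) :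
    PreservesFermat (dunit ω h t) := by
  apply Set.Subset.antisymm
  · rintro _ ⟨v, hv, rfl⟩
    exact (dunit_ferm hω3 h t v).trans hv
  · intro v hv
    have e : (dunit ω h t : Matrix (Fin 4) (Fin 4) F).mulVec
        (((dunit ω h t)⁻¹ : (Matrix (Fin 4) (Fin 4) F)ˣ) |>.val.mulVec v) = v := by
      rw [Matrix.mulVec_mulVec, Units.mul_inv, Matrix.one_mulVec]
    refine ⟨((dunit ω h t)⁻¹ : (Matrix (Fin 4) (Fin 4) F)ˣ).val.mulVec v, ?_, e⟩
    have := dunit_ferm hω3 h t (((dunit ω h t)⁻¹ : (Matrix (Fin 4) (Fin 4) F)ˣ).val.mulVec v)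
    rw [e] at this
    exact this.symm.trans hv

lemma dunit_charpoly {ω : F} (h : ω ≠ 0) (t : Finset (Fin 4)) (ht : t.card = 2) :
    (dunit ω h t : Matrix (Fin 4) (Fin 4) F).charpoly = (X - 1) ^ 2 * (X - C ω) ^ 2 := by
  simp only [dunit, Matrix.charpoly_diagonal]
  have hc : tᶜ.card = 2 := by rw [Finset.card_compl, ht]; rfl
  rw [← Finset.prod_mul_prod_compl t, mul_comm]
  congr 1
  · rw [← hc, ← Finset.prod_const]
    refine Finset.prod_congr rfl fun i hi => ?_
    rw [if_neg (Finset.mem_compl.1 hi), C_1]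
  · rw [← ht, ← Finset.prod_const]
    refine Finset.prod_congr rfl fun i hi => ?_
    rw [if_pos hi]

lemma exists_diag [IsAlgClosed F] (h2 : (2 : F) ≠ 0) (h3 : (3 : F) ≠ 0) {η : F}
    (hη3 : η ^ 3 = 1) (hη : η ≠ 1) (g g' : (Matrix (Fin 4) (Fin 4) F)ˣ)
    (hgg : (QuotientGroup.mk g : PGL4 F) = QuotientGroup.mk g') (hg : PreservesFermat g)
    (hc : (g' : Matrix (Fin 4) (Fin 4) F).charpoly = (X - 1) ^ 2 * (X - C η) ^ 2) :
    ∃ t : Finset (Fin 4), t.card = 2 ∧ (g' : Matrix (Fin 4) (Fin 4) F) =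
      Matrix.diagonal fun i => if i ∈ t then η else 1 := by
  classical
  have h6 : (6 : F) ≠ 0 := by
    rw [show (6 : F) = 2 * 3 by norm_num]; exact mul_ne_zero h2 h3
  obtain ⟨c, hcc⟩ := (mk_eq_iff g g').1 hgg
  have hd := rows_disjoint h6 g _ (scale_all h3 hη3 hη _ (preserves_maps hg))
  have hd' : ∀ i j k : Fin 4, j ≠ k →
      (g' : Matrix (Fin 4) (Fin 4) F) i j * (g' : Matrix (Fin 4) (Fin 4) F) i k = 0 := by
    intro i j k hjk
    rw [hcc, Matrix.smul_apply, Matrix.smul_apply, smul_mul_smul_comm, hd i j k hjk, smul_zero]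
  obtain ⟨d, hdiag, hval, hsum⟩ := monomial_class h2 h3 hη3 hη g' hd' hc
  refine ⟨Finset.univ.filter fun i => d i = η, ?_, ?_⟩
  · have hη' : η - 1 ≠ 0 := sub_ne_zero.2 hη
    have hs : ((Finset.univ.filter fun i => d i = η).card : F) = 2 := by
      have h1 : ∀ i, d i = 1 + (η - 1) * (if d i = η then 1 else 0) := by
        intro i
        rcases hval i with h | h
        · rw [if_neg (by rw [h]; exact hη.symm), h]; ring
        · rw [if_pos h, h]; ring
      rw [Finset.card_filter]
      push_cast
      rw [Fin.sum_univ_four]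
      apply mul_left_cancel₀ hη'
      linear_combination hsum - h1 0 - h1 1 - h1 2 - h1 3
    have hle : (Finset.univ.filter fun i => d i = η).card ≤ 4 :=
      (Finset.card_le_univ _).trans (by simp)
    generalize (Finset.univ.filter fun i => d i = η).card = n at hs hle
    interval_cases n
    · exact absurd (by simpa using hs.symm) h2
    · exact absurd (by push_cast at hs; linear_combination -hs) (one_ne_zero (α := F))
    · rfl
    · exact absurd (by push_cast at hs; linear_combination hs) (one_ne_zero (α := F))
    · exact absurd (by push_cast at hs; linear_combination hs) h2
  · rw [hdiag]
    congr 1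
    ext i
    rcases hval i with h | h
    · simp [h, hη.symm]
    · simp [h]

lemma a2_set [IsAlgClosed F] (h2 : (2 : F) ≠ 0) (h3 : (3 : F) ≠ 0) {ω : F}
    (hω3 : ω ^ 3 = 1) (hω : ω ≠ 1) (h0 : ω ≠ 0) :
    {x : PGL4 F | x ∈ autFermat F ∧ TypeA2 ω x} =
      (fun t => (QuotientGroup.mk (dunit ω h0 t) : PGL4 F)) ''
        ((Finset.univ : Finset (Fin 4)).powersetCard 2 : Set (Finset (Fin 4))) := by
  ext x
  constructor
  · rintro ⟨⟨g, rfl, hg⟩, g', hg', hc | hc⟩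
    · obtain ⟨t, ht, hd⟩ := exists_diag h2 h3 hω3 hω g g' hg'.symm hg hc
      refine ⟨t, by simpa using ht, ?_⟩
      rw [← hg']
      exact (mk_eq_iff _ _).2 ⟨1, by rw [hd, one_smul]; rfl⟩
    · have hη3 : (ω ^ 2) ^ 3 = 1 := by rw [← pow_mul, mul_comm 2 3, pow_mul, hω3, one_pow]
      have hη : ω ^ 2 ≠ 1 := by
        intro h
        apply hω
        linear_combination hω3 - ω * h
      obtain ⟨t, ht, hd⟩ := exists_diag h2 h3 hη3 hη g g' hg'.symm hg hc
      refine ⟨tᶜ, ?_, ?_⟩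
      · have : tᶜ.card = 2 := by rw [Finset.card_compl, ht]; rfl
        simpa using this
      · rw [← hg']
        refine (mk_eq_iff _ _).2 ⟨ω ^ 2, ?_⟩
        rw [hd]
        simp only [dunit]
        rw [← Matrix.diagonal_smul]
        congr 1
        ext i
        by_cases hi : i ∈ t
        · simp [hi]
        · simp [hi]
          linear_combination -hω3
  · rintro ⟨t, ht, rfl⟩
    refine ⟨⟨_, rfl, dunit_preserves hω3 h0 t⟩, _, rfl, Or.inl (dunit_charpoly h0 t ?_)⟩
    simpa using ht

end Helpers

/-- Let `F` be an algebraically closed field of characteristic different from `2` and `3`,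
with a primitive cube root of unity `ω`. Then the automorphism group of the Fermat cubic
surface contains exactly `6` elements of type `A₂`, and they pairwise commute. -/
theorem stmt_14 (F : Type*) [Field F] [IsAlgClosed F]
    (hchar2 : (2 : F) ≠ 0) (hchar3 : (3 : F) ≠ 0)
    (ω : F) (hω3 : ω ^ 3 = 1) (hω : ω ≠ 1) :
    {x : PGL4 F | x ∈ autFermat F ∧ TypeA2 ω x}.ncard = 6 ∧
      ∀ x ∈ {x : PGL4 F | x ∈ autFermat F ∧ TypeA2 ω x},
        ∀ y ∈ {x : PGL4 F | x ∈ autFermat F ∧ TypeA2 ω x}, x * y = y * x := by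
  have h0 : ω ≠ 0 := by
    rintro rfl
    simp at hω3
  rw [a2_set hchar2 hchar3 hω3 hω h0]
  constructor
  · rw [Set.ncard_image_of_injOn, Set.ncard_coe_finset, Finset.card_powersetCard]
    · rfl
    · intro t ht t' ht' h
      have ht : t.card = 2 := by simpa using ht
      have ht' : t'.card = 2 := by simpa using ht'
      obtain ⟨c, hc⟩ := (mk_eq_iff _ _).1 h
      have hci : ∀ i, (if i ∈ t' then ω else 1) = c * (if i ∈ t then ω else 1) := by
        intro i
        have := congrFun (congrFun hc i) i
        simpa only [dunit, Matrix.smul_apply, Matrix.diagonal_apply_eq, smul_eq_mul] using this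
      by_contra hne
      have h1 : ∃ i ∈ t, i ∉ t' := by
        by_contra! hcon
        exact hne (Finset.eq_of_subset_of_card_le hcon (by rw [ht, ht']))
      have h2 : ∃ i ∈ t', i ∉ t := by
        by_contra! hcon
        exact hne (Finset.eq_of_subset_of_card_le hcon (by rw [ht, ht'])).symm
      obtain ⟨i, hi, hi'⟩ := h1
      obtain ⟨j, hj, hj'⟩ := h2
      have e1 := hci i
      have e2 := hci j
      rw [if_neg hi', if_pos hi] at e1
      rw [if_pos hj, if_neg hj'] at e2
      apply hω
      linear_combination hω3 - ω * (ω * e2 - e1)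
  · rintro _ ⟨t, -, rfl⟩ _ ⟨t', -, rfl⟩
    change (QuotientGroup.mk (dunit ω h0 t * dunit ω h0 t') : PGL4 F) =
      QuotientGroup.mk (dunit ω h0 t' * dunit ω h0 t)
    congr 1
    apply Units.ext
    simp only [Units.val_mul, dunit, Matrix.diagonal_mul_diagonal]
    congr 1
    ext i
    ring
end

section
/- Let F be an infinite perfect field with algebraic closure F̄, and let Γ = Aut(F̄/F) act on F̄^{n+1} coordinatewise (semilinearly), so that each σ ∈ Γ maps an F̄-linear subspace L ⊆ F̄^{n+1} to a subspace σ(L). Let L₁,…,Lₘ and L′₁,…,L′ₘ be two families of pairwise distinct nonzero F̄-linear subspaces of F̄^{n+1}. Assume: (1) there exists φ ∈ GL_{n+1}(F̄) with φ(Lᵢ) = L′ᵢ for all i; and (2) for every σ ∈ Γ and every i there is an index j with σ(Lᵢ) = Lⱼ, and for this j one also has σ(L′ᵢ) = L′ⱼ. Then there exists ψ ∈ GL_{n+1}(F) such that (the F̄-linear extension of) ψ satisfies ψ(Lᵢ) = L′ᵢ for all i. -/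
instance algEquiv_ringHomSurjective {F K : Type*} [Field F] [Field K] [Algebra F K]
    (σ : K ≃ₐ[F] K) : RingHomSurjective (σ : K →+* K) :=
  ⟨σ.surjective⟩

/-- The coordinatewise (semilinear) action of a Galois automorphism `σ ∈ Aut(K/F)` on
`K^{n+1}`; it maps `K`-linear subspaces to `K`-linear subspaces via `Submodule.map`. -/
def galMap {F K : Type*} [Field F] [Field K] [Algebra F K] (n : ℕ) (σ : K ≃ₐ[F] K) :
    (Fin (n + 1) → K) →ₛₗ[(σ : K →+* K)] (Fin (n + 1) → K) where
  toFun v := fun i => σ (v i)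
  map_add' u v := by funext i; simp
  map_smul' c v := by funext i; simp

theorem descent_aux {F K : Type*} [Field F] [Field K] [Algebra F K] {d : Type*} [Fintype d]
    (W : Submodule K (Matrix d d K))
    (hW : ∀ σ : K ≃ₐ[F] K, ∀ M ∈ W, M.map σ ∈ W) :
    ∀ (k : ℕ) (M : Matrix d d K), M ∈ W →
      (Set.ncard {p : d × d | M p.1 p.2 ≠ 0}) = k →
      M ∈ Submodule.span K {M : Matrix d d K | M ∈ W ∧ ∀ σ : K ≃ₐ[F] K, M.map σ = M} := by
  intro k
  induction k using Nat.strong_induction_on with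
  | _ k ih =>
  intro M hM hk
  by_cases h0 : M = 0
  · rw [h0]; exact Submodule.zero_mem _
  by_cases hA : ∃ E ∈ W, E ≠ 0 ∧ {p : d × d | E p.1 p.2 ≠ 0} ⊂ {p : d × d | M p.1 p.2 ≠ 0}
  · obtain ⟨E, hE, hE0, hsub⟩ := hA
    have h1 := ih _ (hk ▸ Set.ncard_lt_ncard hsub (Set.toFinite _)) E hE rfl
    obtain ⟨a, b, hab⟩ : ∃ a b, E a b ≠ 0 := by
      by_contra! h
      exact hE0 (by ext a b; exact h a b)
    have hss : {p : d × d | (M - (M a b / E a b) • E) p.1 p.2 ≠ 0} ⊂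
        {p : d × d | M p.1 p.2 ≠ 0} := by
      refine ⟨?_, ?_⟩
      · intro p hp hp0
        have : E p.1 p.2 = 0 := by
          by_contra h
          exact hsub.1 h hp0
        apply hp
        simp [this, hp0]
      · intro h
        have h2 : (a, b) ∈ {p : d × d | M p.1 p.2 ≠ 0} := hsub.1 hab
        have h3 := h h2
        apply h3
        simp [hab]
    have h2 := ih _ (hk ▸ Set.ncard_lt_ncard hss (Set.toFinite _)) _
      (W.sub_mem hM (W.smul_mem _ hE)) rfl
    have h3 := Submodule.add_mem _ h2 (Submodule.smul_mem _ (M a b / E a b) h1)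
    simpa using h3
  · obtain ⟨a, b, hab⟩ : ∃ a b, M a b ≠ 0 := by
      by_contra! h
      exact h0 (by ext a b; exact h a b)
    have hN : (M a b)⁻¹ • M ∈ W := W.smul_mem _ hM
    have hfix : ∀ σ : K ≃ₐ[F] K, ((M a b)⁻¹ • M).map σ = (M a b)⁻¹ • M := by
      intro σ
      by_contra hne
      apply hA
      refine ⟨((M a b)⁻¹ • M).map σ - (M a b)⁻¹ • M, W.sub_mem (hW σ _ hN) hN,
        sub_ne_zero.2 hne, ?_, ?_⟩
      · intro p hp hp0
        apply hp
        simp [hp0]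
      · intro h
        have h2 : (a, b) ∈ {p : d × d | M p.1 p.2 ≠ 0} := hab
        apply h h2
        simp [hab]
    have h3 : (M a b)⁻¹ • M ∈
        Submodule.span K {M : Matrix d d K | M ∈ W ∧ ∀ σ : K ≃ₐ[F] K, M.map σ = M} :=
      Submodule.subset_span ⟨hN, hfix⟩
    have h4 := Submodule.smul_mem _ (M a b) h3
    rwa [smul_smul, mul_inv_cancel₀ hab, one_smul] at h4

theorem exists_det_ne_zero {F K : Type*} [Field F] [Infinite F] [Field K] [Algebra F K]
    {d ι : Type*} [Fintype d] [DecidableEq d] [Fintype ι]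
    (N : ι → Matrix d d F) (c : ι → K)
    (h : (∑ k, c k • (N k).map (algebraMap F K)).det ≠ 0) :
    ∃ x : ι → F, (∑ k, x k • N k).det ≠ 0 := by
  by_contra! hx
  let P : Matrix d d (MvPolynomial ι F) :=
    ∑ k, (MvPolynomial.X k : MvPolynomial ι F) • (N k).map MvPolynomial.C
  have hP : P.det = 0 := by
    apply MvPolynomial.funext
    intro x
    rw [map_zero, ← hx x, RingHom.map_det]
    congr 1
    ext a b
    simp [P, Matrix.sum_apply]
  apply h
  have : MvPolynomial.aeval c P.det = 0 := by rw [hP, map_zero]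
  rw [← this, AlgHom.map_det]
  congr 1
  ext a b
  simp [P, Matrix.sum_apply]

/-- Let `F` be an infinite perfect field with algebraic closure `K`, and let `L₁,…,Lₘ` and
`L′₁,…,L′ₘ` be families of pairwise distinct nonzero `K`-subspaces of `K^{n+1}`. Assume some
`φ ∈ GL_{n+1}(K)` satisfies `φ(Lᵢ) = L′ᵢ` for all `i`, and that the bijection `Lᵢ ↦ L′ᵢ`
commutes with the coordinatewise Galois action (for each `σ ∈ Aut(K/F)` and each `i` there
is `j` with `σ(Lᵢ) = Lⱼ` and `σ(L′ᵢ) = L′ⱼ`). Then some `ψ ∈ GL_{n+1}(F)` satisfies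
`ψ(Lᵢ) = L′ᵢ` for all `i`. -/
theorem stmt_16 (F K : Type*) [Field F] [Infinite F] [PerfectField F]
    [Field K] [Algebra F K] [IsAlgClosed K] [Algebra.IsAlgebraic F K]
    (n m : ℕ)
    (L L' : Fin m → Submodule K (Fin (n + 1) → K))
    (hLinj : Function.Injective L) (hL'inj : Function.Injective L')
    (hLne : ∀ i, L i ≠ ⊥) (hL'ne : ∀ i, L' i ≠ ⊥)
    (φ : (Matrix (Fin (n + 1)) (Fin (n + 1)) K)ˣ)
    (hφ : ∀ i, (L i).map
      (Matrix.mulVecLin (φ : Matrix (Fin (n + 1)) (Fin (n + 1)) K)) = L' i)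
    (hGal : ∀ σ : K ≃ₐ[F] K, ∀ i, ∃ j,
      (L i).map (galMap n σ) = L j ∧ (L' i).map (galMap n σ) = L' j) :
    ∃ ψ : (Matrix (Fin (n + 1)) (Fin (n + 1)) F)ˣ, ∀ i,
      (L i).map (Matrix.mulVecLin
        (((ψ : Matrix (Fin (n + 1)) (Fin (n + 1)) F)).map (algebraMap F K))) = L' i := by
  classical
  have : IsGalois F K :=
    { to_isSeparable := inferInstance
      to_normal := normal_iff.2 fun x =>
        ⟨Algebra.IsIntegral.isIntegral x, IsAlgClosed.splits _⟩ }
  let W : Submodule K (Matrix (Fin (n + 1)) (Fin (n + 1)) K) :=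
    { carrier := {M | ∀ i, ∀ v ∈ L i, M.mulVec v ∈ L' i}
      add_mem' := by
        intro A B hA hB i v hv
        rw [Matrix.add_mulVec]
        exact (L' i).add_mem (hA i v hv) (hB i v hv)
      zero_mem' := by
        intro i v hv
        rw [Matrix.zero_mulVec]
        exact (L' i).zero_mem
      smul_mem' := by
        intro c A hA i v hv
        rw [Matrix.smul_mulVec]
        exact (L' i).smul_mem _ (hA i v hv) }
  have hW : ∀ σ : K ≃ₐ[F] K, ∀ M ∈ W, M.map σ ∈ W := by
    intro σ M hM i v hv
    obtain ⟨j, h1, h2⟩ := hGal σ.symm i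
    have hv' : galMap n σ.symm v ∈ L j := h1 ▸ Submodule.mem_map_of_mem hv
    have h3 := hM j _ hv'
    rw [← h2] at h3
    obtain ⟨u, hu, hu'⟩ := h3
    have : (M.map σ).mulVec v = u := by
      ext a
      have := congrFun hu' a
      have h4 := congrArg σ this
      simp only [galMap, Matrix.mulVec, dotProduct, LinearMap.coe_mk, AddHom.coe_mk,
        AlgEquiv.apply_symm_apply, map_sum, map_mul] at h4
      simp only [Matrix.mulVec, dotProduct, Matrix.map_apply]
      exact h4.symm
    rw [this]
    exact hu
  have hφW : (φ : Matrix (Fin (n + 1)) (Fin (n + 1)) K) ∈ W := by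
    intro i v hv
    rw [← hφ i]
    exact ⟨v, hv, rfl⟩
  have hspan := descent_aux W hW _ _ hφW rfl
  obtain ⟨ι, hfin, c, g, hsum⟩ : ∃ (ι : Type _) (_ : Fintype ι) (c : ι → K)
      (g : ι → {M : Matrix (Fin (n + 1)) (Fin (n + 1)) K //
        M ∈ W ∧ ∀ σ : K ≃ₐ[F] K, M.map σ = M}),
      ∑ k, c k • (g k : Matrix (Fin (n + 1)) (Fin (n + 1)) K) = φ := by
    obtain ⟨k, c, g, h⟩ := Submodule.mem_span_set'.1 hspan
    exact ⟨Fin k, inferInstance, c, g, h⟩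
  have hN : ∀ k, ∃ N : Matrix (Fin (n + 1)) (Fin (n + 1)) F, N.map (algebraMap F K) = g k := by
    intro k
    have : ∀ a b, ∃ y : F, algebraMap F K y = (g k).1 a b := by
      intro a b
      refine (InfiniteGalois.mem_range_algebraMap_iff_fixed _).2 fun σ => ?_
      exact congrFun (congrFun ((g k).2.2 σ) a) b
    choose y hy using this
    exact ⟨Matrix.of y, by ext a b; exact hy a b⟩
  choose N hN using hN
  obtain ⟨x, hx⟩ := exists_det_ne_zero (K := K) N c (by
    simp only [hN]
    rw [hsum]
    exact ((Matrix.isUnit_iff_isUnit_det _).1 φ.isUnit).ne_zero)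
  obtain ⟨ψ, hψ⟩ := (Matrix.isUnit_iff_isUnit_det _).2 hx.isUnit
  refine ⟨ψ, fun i => ?_⟩
  have hψW : (ψ : Matrix (Fin (n + 1)) (Fin (n + 1)) F).map (algebraMap F K) ∈ W := by
    have : (ψ : Matrix (Fin (n + 1)) (Fin (n + 1)) F).map (algebraMap F K) =
        ∑ k, algebraMap F K (x k) • (g k : Matrix (Fin (n + 1)) (Fin (n + 1)) K) := by
      rw [hψ]
      ext a b
      simp [← hN, Matrix.sum_apply]
      simp only [Algebra.smul_def]
    rw [this]
    exact Submodule.sum_mem _ fun k _ => W.smul_mem _ (g k).2.1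
  have inj1 : Function.Injective (Matrix.mulVecLin (φ : Matrix (Fin (n + 1)) (Fin (n + 1)) K)) :=
    Matrix.mulVec_injective_of_isUnit φ.isUnit
  have inj2 : Function.Injective (Matrix.mulVecLin
      ((ψ : Matrix (Fin (n + 1)) (Fin (n + 1)) F).map (algebraMap F K))) :=
    Matrix.mulVec_injective_of_isUnit (ψ.isUnit.map (algebraMap F K).mapMatrix)
  apply Submodule.eq_of_le_of_finrank_eq
  · rintro _ ⟨v, hv, rfl⟩
    exact hψW i v hv
  · rw [← hφ i, ← (Submodule.equivMapOfInjective _ inj1 (L i)).finrank_eq,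
      ← (Submodule.equivMapOfInjective _ inj2 (L i)).finrank_eq]
end
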